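/- Every almost indiscernible countable complete theory T is finite-dimensional: there are only finitely many regular types up to nonorthogonality. -/

import Mathlib

open FirstOrder Language Cardinal Set

universe u v w

namespace Paper

variable {L : FirstOrder.Language.{u, v}}

/-- `a` and `b` (as `n`-tuples) satisfy the same formulas with parameters from `A`. -/
def SameType {M : Type w} [L.Structure M] (A : Set M) {n : ℕ} (a b : Fin n → M) : Prop :=
  ∀ φ : L.Formula (↥A ⊕ Fin n),
    φ.Realize (Sum.elim (fun x => (x : M)) a) ↔ φ.Realize (Sum.elim (fun x => (x : M)) b)

/-- `a` and `b` satisfy the same formulas over the empty set. -/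
def SameType₀ {M : Type w} [L.Structure M] {n : ℕ} (a b : Fin n → M) : Prop :=
  ∀ φ : L.Formula (Fin n), φ.Realize a ↔ φ.Realize b

/-- `M` is `κ`-saturated: every finitely satisfiable (in `M`) collection of formulas in one
variable over a parameter set of size `< κ` is realized in `M`. -/
def IsSat (M : Type w) [L.Structure M] (κ : Cardinal.{w}) : Prop :=
  ∀ A : Set M, #A < κ →
    ∀ p : Set (L.Formula (↥A ⊕ Fin 1)),
      (∀ S : Finset (L.Formula (↥A ⊕ Fin 1)), ↑S ⊆ p →
        ∃ a : Fin 1 → M, ∀ φ ∈ S, φ.Realize (Sum.elim (fun x => (x : M)) a)) →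
      ∃ a : Fin 1 → M, ∀ φ ∈ p, φ.Realize (Sum.elim (fun x => (x : M)) a)

/-- `b` is algebraic over `A` in `M`. -/
def InAcl {M : Type w} [L.Structure M] (A : Set M) (b : M) : Prop :=
  ∃ φ : L.Formula (↥A ⊕ Fin 1),
    φ.Realize (Sum.elim (fun x => (x : M)) (fun _ => b)) ∧
    {x : M | φ.Realize (Sum.elim (fun x => (x : M)) (fun _ => x))}.Finite

/-- A set `I` of `k`-tuples is an indiscernible set: any two injective enumerations
of `n` elements of `I` satisfy the same formulas over `∅`. -/
def IsIndiscSet {M : Type w} [L.Structure M] {k : ℕ} (I : Set (Fin k → M)) : Prop :=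
  ∀ (n : ℕ) (a b : Fin n → (Fin k → M)), Function.Injective a → Function.Injective b →
    (∀ i, a i ∈ I) → (∀ i, b i ∈ I) →
    ∀ φ : L.Formula (Fin n × Fin k),
      (φ.Realize fun p => a p.1 p.2) ↔ (φ.Realize fun p => b p.1 p.2)

/-- The set of all coordinates of the tuples in `I`. -/
def coords {M : Type w} {k : ℕ} (I : Set (Fin k → M)) : Set M :=
  ⋃ e ∈ I, Set.range e

/-- A theory is almost indiscernible if it has a saturated model of cardinality `ℵ₁` which is
contained in the algebraic closure of an indiscernible set of finite tuples of cardinality `ℵ₁`. -/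
def AlmostIndiscernible (T : L.Theory) : Prop :=
  ∃ (M : Type (max u v)) (_ : L.Structure M), M ⊨ T ∧ #M = ℵ₁ ∧ IsSat (L := L) M ℵ₁ ∧
    ∃ (k : ℕ) (I : Set (Fin k → M)), IsIndiscSet (L := L) I ∧ #I = ℵ₁ ∧ ∀ b : M, InAcl (L := L) (coords I) b

/-- A complete type over `A` in one variable, identified with a maximal finitely satisfiable
set of formulas over `A`. -/
def IsCompleteTypeOver (M : Type w) [L.Structure M] (A : Set M)
    (p : Set (L.Formula (↥A ⊕ Fin 1))) : Prop :=
  (∀ S : Finset (L.Formula (↥A ⊕ Fin 1)), ↑S ⊆ p →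
    ∃ a : Fin 1 → M, ∀ φ ∈ S, φ.Realize (Sum.elim (fun x => (x : M)) a)) ∧
  (∀ φ : L.Formula (↥A ⊕ Fin 1), φ ∈ p ∨ φ.not ∈ p)

/-- `T` is `ω`-stable: over every countable parameter set in a model of `T` there are only
countably many complete types. -/
def IsOmegaStable (T : L.Theory) : Prop :=
  ∀ (M : Type (max u v)) (_ : L.Structure M), M ⊨ T →
    ∀ A : Set M, A.Countable → {p | IsCompleteTypeOver (L := L) M A p}.Countable

section Rank

variable {M : Type w} [L.Structure M]

/-- Realization of a formula with parameters from all of `M`. -/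
def RealP {n : ℕ} (φ : L.Formula (M ⊕ Fin n)) (a : Fin n → M) : Prop :=
  φ.Realize (Sum.elim id a)

/-- Morley rank (computed in `M`) of a definable set is at least `α`. -/
def MRGe {n : ℕ} (φ : L.Formula (M ⊕ Fin n)) (α : Ordinal.{0}) : Prop :=
  (∃ a, RealP φ a) ∧ ∀ β < α, ∃ ψ : ℕ → L.Formula (M ⊕ Fin n),
    (∀ i a, RealP (ψ i) a → RealP φ a) ∧
    (∀ i j, i ≠ j → ∀ a, ¬(RealP (ψ i) a ∧ RealP (ψ j) a)) ∧
    ∀ i, MRGe (ψ i) β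
termination_by α
decreasing_by exact ‹_ < α›

/-- Morley rank (computed in `M`) is exactly `α`. -/
def MREq {n : ℕ} (φ : L.Formula (M ⊕ Fin n)) (α : Ordinal.{0}) : Prop :=
  MRGe φ α ∧ ¬ MRGe φ (α + 1)

/-- Every formula over `A` satisfied by `a` has Morley rank at least `α`. -/
def TpRkGe (A : Set M) {n : ℕ} (a : Fin n → M) (α : Ordinal.{0}) : Prop :=
  ∀ φ : L.Formula (↥A ⊕ Fin n),
    φ.Realize (Sum.elim (fun x => (x : M)) a) →
    MRGe (L := L) (φ.relabel (Sum.map (fun x : ↥A => (x : M)) id)) α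

/-- `a` is (forking-)independent from `B` over `A`: the Morley rank of its type does not
drop when the parameters are extended from `A` to `A ∪ B`. -/
def Indep (A : Set M) {n : ℕ} (a : Fin n → M) (B : Set M) : Prop :=
  ∀ α : Ordinal.{0}, TpRkGe (L := L) (A ∪ B) a α ↔ TpRkGe (L := L) A a α

/-- An independent family of realizations: each member is independent from all the others. -/
def IndepFamily (A : Set M) {n : ℕ} {ι : Type*} (J : ι → (Fin n → M)) : Prop :=
  ∀ i : ι, Indep (L := L) A (J i) (⋃ j ∈ {j | j ≠ i}, Set.range (J j))

/-- `tp(a/A)` is stationary (w.r.t. parameter sets of size `< κ`). -/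
def Stationary (κ : Cardinal.{w}) (A : Set M) {n : ℕ} (a : Fin n → M) : Prop :=
  ∀ B : Set M, A ⊆ B → #B < κ → ∀ a' a'' : Fin n → M,
    SameType (L := L) A a' a → SameType (L := L) A a'' a → Indep (L := L) A a' B → Indep (L := L) A a'' B → SameType (L := L) B a' a''

/-- `tp(a/A)` and `tp(b/B)` are nonorthogonal (w.r.t. parameter sets of size `< κ`). -/
def Nonorthogonal (κ : Cardinal.{w}) (A : Set M) {n : ℕ} (a : Fin n → M)
    (B : Set M) {m : ℕ} (b : Fin m → M) : Prop :=
  ∃ C : Set M, A ∪ B ⊆ C ∧ #C < κ ∧ ∃ (a' : Fin n → M) (b' : Fin m → M),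
    SameType (L := L) A a' a ∧ Indep (L := L) A a' C ∧ SameType (L := L) B b' b ∧
    Indep (L := L) B b' C ∧ ¬ Indep (L := L) C a' (Set.range b')

/-- `tp(a/A)` is regular: stationary, nonalgebraic, and orthogonal to all of its forking
extensions. -/
def Regular (κ : Cardinal.{w}) (A : Set M) {n : ℕ} (a : Fin n → M) : Prop :=
  Stationary (L := L) κ A a ∧ (∃ i, ¬ InAcl (L := L) A (a i)) ∧
  ∀ B : Set M, A ⊆ B → #B < κ → ∀ a' : Fin n → M,
    SameType (L := L) A a' a → ¬ Indep (L := L) A a' B → ¬ Nonorthogonal (L := L) κ A a B a'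

/-- U-rank of `tp(a/A)` is at least `α`. -/
def URkGe (κ : Cardinal.{w}) (A : Set M) {n : ℕ} (a : Fin n → M) (α : Ordinal.{0}) : Prop :=
  ∀ β < α, ∃ (B : Set M) (a' : Fin n → M), A ⊆ B ∧ #B < κ ∧
    SameType (L := L) A a' a ∧ ¬ Indep (L := L) A a' B ∧ URkGe κ B a' β
termination_by α
decreasing_by exact ‹_ < α›

end Rank

section Algebra

/-- The theory `T` is equational: every axiom is a universally quantified equation
between terms. -/
def IsEquational (T : L.Theory) : Prop :=
  ∀ φ ∈ T, ∃ (n : ℕ) (t₁ t₂ : L.Term (Empty ⊕ Fin n)),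
    φ = BoundedFormula.alls (t₁.bdEqual t₂)

/-- `A` is free on `X ⊆ A` over the class of models of `T`: `A ⊨ T` and every map from `X`
into a model of `T` extends uniquely to a homomorphism. -/
def IsFreeOn (T : L.Theory) (A : Type w) [L.Structure A] (X : Set A) : Prop :=
  A ⊨ T ∧ ∀ (B : Type w) (_ : L.Structure B), B ⊨ T →
    ∀ f : X → B, ∃! h : A →[L] B, ∀ x : X, h x = f x

/-- An element of a free algebra is basic if it belongs to some basis. -/
def IsBasic (T : L.Theory) {M : Type w} [L.Structure M] (a : M) : Prop :=
  ∃ X : Set M, a ∈ X ∧ IsFreeOn T M X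

/-- A subset of a free algebra is basic if it is contained in some basis. -/
def IsBasicSet (T : L.Theory) {M : Type w} [L.Structure M] (A : Set M) : Prop :=
  ∃ X : Set M, A ⊆ X ∧ IsFreeOn T M X

end Algebra

/-- Tarski–Vaught style: `S` is the underlying set of an elementary substructure. -/
def IsElemSubset {M : Type w} [L.Structure M] (S : Set M) : Prop :=
  S.Nonempty ∧ ∀ (n : ℕ) (φ : L.Formula (Fin (n + 1))) (a : Fin n → M),
    (∀ i, a i ∈ S) → (∃ x : M, φ.Realize (Fin.snoc a x)) →
    ∃ x ∈ S, φ.Realize (Fin.snoc a x)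

/-- Every type over a parameter subset of `S` of size `< κ` that is finitely satisfiable in `M`
is realized inside `S`. -/
def SatInside {M : Type w} [L.Structure M] (S : Set M) (κ : Cardinal.{w}) : Prop :=
  ∀ A : Set M, A ⊆ S → #A < κ →
    ∀ p : Set (L.Formula (↥A ⊕ Fin 1)),
      (∀ Sf : Finset (L.Formula (↥A ⊕ Fin 1)), ↑Sf ⊆ p →
        ∃ a : Fin 1 → M, ∀ φ ∈ Sf, φ.Realize (Sum.elim (fun x => (x : M)) a)) →
      ∃ a : Fin 1 → M, a 0 ∈ S ∧ ∀ φ ∈ p, φ.Realize (Sum.elim (fun x => (x : M)) a)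

end Paper

namespace Paper
variable {L : FirstOrder.Language.{u, v}}

/-- Same type of two (possibly infinite) tuples in two structures. -/
def TE (L : FirstOrder.Language.{u, v}) {M N : Type*} [L.Structure M] [L.Structure N]
    {ι : Type*} (s : ι → M) (t : ι → N) : Prop :=
  ∀ φ : L.Formula ι, φ.Realize s ↔ φ.Realize t

section TE
variable {M N P : Type*} [L.Structure M] [L.Structure N] [L.Structure P] {ι κ : Type*}

theorem TE.refl (s : ι → M) : TE L s s := fun _ => Iff.rfl
theorem TE.symm {s : ι → M} {t : ι → N} (h : TE L s t) : TE L t s := fun φ => (h φ).symm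
theorem TE.trans {s : ι → M} {t : ι → N} {r : ι → P} (h : TE L s t) (h' : TE L t r) : TE L s r :=
  fun φ => (h φ).trans (h' φ)
theorem TE.comp {s : ι → M} {t : ι → N} (h : TE L s t) (g : κ → ι) : TE L (s ∘ g) (t ∘ g) := by
  intro φ
  have := h (φ.relabel g)
  simpa [Formula.realize_relabel] using this
theorem TE.eq_iff {s : ι → M} {t : ι → N} (h : TE L s t) (i j : ι) : s i = s j ↔ t i = t j := by
  have := h ((Term.var i).equal (Term.var j))
  simpa [Formula.realize_equal] using this
theorem TE.ex {s : ι → M} {t : ι → N} (h : TE L s t) [Finite κ] (χ : L.Formula (ι ⊕ κ)) :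
    (∃ x, χ.Realize (Sum.elim s x)) ↔ (∃ x, χ.Realize (Sum.elim t x)) := by
  have := h (χ.iExs κ)
  simpa [Formula.realize_iExs] using this
theorem TE.all {s : ι → M} {t : ι → N} (h : TE L s t) [Finite κ] (χ : L.Formula (ι ⊕ κ)) :
    (∀ x, χ.Realize (Sum.elim s x)) ↔ (∀ x, χ.Realize (Sum.elim t x)) := by
  have := h (χ.iAlls κ)
  simpa [Formula.realize_iAlls] using this
/-- Finite representation of formulas. -/
theorem fin_repr (φ : L.Formula ι) : ∃ (n : ℕ) (g : Fin n → ι) (φ' : L.Formula (Fin n)),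
    (∀ s : ι → M, φ.Realize s ↔ φ'.Realize (s ∘ g)) ∧
    (∀ s : ι → N, φ.Realize s ↔ φ'.Realize (s ∘ g)) := by
  classical
  let e := φ.freeVarFinset.equivFin
  refine ⟨_, fun i => (e.symm i : ι), φ.restrictFreeVar e, ?_, ?_⟩ <;>
  · intro s
    exact (BoundedFormula.realize_restrictFreeVar (v := s ∘ fun i => (e.symm i : ι)) s (by simp)).symm
theorem TE.of_fin {s : ι → M} {t : ι → N}
    (h : ∀ (n : ℕ) (g : Fin n → ι), TE L (s ∘ g) (t ∘ g)) : TE L s t := by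
  intro φ
  obtain ⟨n, g, φ', h1, h2⟩ := fin_repr (M := M) (N := N) φ
  rw [h1, h2]
  exact h n g φ'
end TE

theorem def_range {N : Type*} [L.Structure N] {ι κ : Type*} (t : ι → N) (X : Set (κ → N)) :
    (range t).Definable L X ↔ ∃ φ : L.Formula (ι ⊕ κ), X = {x | φ.Realize (Sum.elim t x)} := by
  rw [definable_iff_exists_formula_sum]
  constructor
  · rintro ⟨φ, rfl⟩
    choose g hg using fun a : range t => a.2
    refine ⟨φ.relabel (Sum.map g id), ?_⟩
    ext x
    simp only [mem_ofPred_eq, Formula.realize_relabel]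
    have : (Sum.elim t x ∘ Sum.map g id) = Sum.elim (fun a : range t => (a : N)) x := by
      funext i; rcases i with i | i <;> simp [hg]
    rw [this]
  · rintro ⟨φ, rfl⟩
    refine ⟨φ.relabel (Sum.map (rangeFactorization t) id), ?_⟩
    ext x
    simp only [mem_ofPred_eq, Formula.realize_relabel]
    have : (Sum.elim (fun a : range t => (a : N)) x ∘ Sum.map (rangeFactorization t) id)
        = Sum.elim t x := by
      funext i; rcases i with i | i <;> simp
    rw [this]

theorem def_set {N : Type*} [L.Structure N] {κ : Type*} (A : Set N) (X : Set (κ → N)) :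
    A.Definable L X ↔ ∃ φ : L.Formula (A ⊕ κ), X = {x | φ.Realize (Sum.elim (fun a : A => (a : N)) x)} := 
  definable_iff_exists_formula_sum

section Ext
variable {M N : Type w} [L.Structure M] [L.Structure N] {ι : Type*}

theorem ext_one {κ : Cardinal.{w}} (hN : IsSat (L := L) N κ) {s : ι → M} {t : ι → N}
    (h : TE L s t) (ht : #(range t) < κ) (x : M) :
    ∃ y : N, TE L (Sum.elim s (fun _ : Fin 1 => x)) (Sum.elim t (fun _ : Fin 1 => y)) := by
  have key : ∀ (ψ : L.Formula (ι ⊕ Fin 1)) (y : Fin 1 → N),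
      (ψ.relabel (Sum.map (rangeFactorization t) id)).Realize
        (Sum.elim (fun x : range t => (x : N)) y) ↔ ψ.Realize (Sum.elim t y) := by
    intro ψ y
    rw [Formula.realize_relabel]
    have : (Sum.elim (fun a : range t => (a : N)) y ∘ Sum.map (rangeFactorization t) id)
        = Sum.elim t y := by
      funext i; rcases i with i | i <;> simp
    rw [this]
  obtain ⟨a, ha⟩ := hN (range t) ht
    {φ | ∃ ψ : L.Formula (ι ⊕ Fin 1), ψ.Realize (Sum.elim s (fun _ => x)) ∧
      φ = ψ.relabel (Sum.map (rangeFactorization t) id)} (by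
    classical
    intro S hS
    have : ∃ ψ : L.Formula (ι ⊕ Fin 1), ψ.Realize (Sum.elim s (fun _ => x)) ∧
        ∀ y : Fin 1 → N, ψ.Realize (Sum.elim t y) → ∀ φ ∈ S, φ.Realize
        (Sum.elim (fun x : range t => (x : N)) y) := by
      induction S using Finset.induction_on with
      | empty => exact ⟨⊤, by simp, by simp⟩
      | insert φ S hφ ih =>
        obtain ⟨ψ, h1, h2⟩ := ih (fun z hz => hS (by simp at hz ⊢; exact Or.inr hz))
        obtain ⟨ψ', h1', rfl⟩ := hS (Finset.mem_coe.2 (Finset.mem_insert_self φ S))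
        refine ⟨ψ ⊓ ψ', by simp [h1, h1'], ?_⟩
        intro y hy φ hφ
        simp only [Formula.realize_inf] at hy
        rcases Finset.mem_insert.1 hφ with rfl | hφ
        · exact (key _ _).2 hy.2
        · exact h2 y hy.1 φ hφ
    obtain ⟨ψ, h1, h2⟩ := this
    obtain ⟨y, hy⟩ := (h.ex ψ).1 ⟨_, h1⟩
    exact ⟨y, h2 y hy⟩)
  refine ⟨a 0, ?_⟩
  have e : (fun _ : Fin 1 => a 0) = a := by funext i; rw [Subsingleton.elim i 0]
  have main : ∀ ψ : L.Formula (ι ⊕ Fin 1), ψ.Realize (Sum.elim s (fun _ => x)) →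
      ψ.Realize (Sum.elim t (fun _ : Fin 1 => a 0)) := by
    intro ψ hψ
    rw [e, ← key]
    exact ha _ ⟨ψ, hψ, rfl⟩
  intro ψ
  refine ⟨main ψ, fun h' => ?_⟩
  by_contra hc
  have := main ψ.not (by simpa using hc)
  simp only [Formula.realize_not] at this
  exact this h'

theorem ext_many {κ : Cardinal.{w}} (hκ : ℵ₀ ≤ κ) (hN : IsSat (L := L) N κ) {s : ι → M} {t : ι → N}
    (h : TE L s t) (ht : #(range t) < κ) {ι' : Type w} (hι' : #ι' < κ) (c : ι' → M) :
    ∃ c' : ι' → N, TE L (Sum.elim s c) (Sum.elim t c') := by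
  let Q : Set (Set (ι' × N)) := {G | TE L (Sum.elim s (fun p : G => c p.1.1))
    (Sum.elim t (fun p : G => p.1.2))}
  obtain ⟨G, hGmax⟩ : ∃ G, Maximal (· ∈ Q) G := by
    apply zorn_subset
    intro ch hch hchain
    rcases ch.eq_empty_or_nonempty with rfl | hne
    · refine ⟨∅, ?_, by simp⟩
      show TE L _ _
      apply TE.of_fin
      intro n g
      have : ∀ i, ∃ j, g i = Sum.inl j := by
        intro i
        rcases hgi : g i with j | j
        · exact ⟨j, rfl⟩
        · exact absurd j.2 (notMem_empty _)
      choose g' hg' using this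
      have h1 := h.comp g'
      convert h1 using 1 <;> funext i <;> simp [hg']
    · refine ⟨⋃₀ ch, ?_, fun z hz => subset_sUnion_of_mem hz⟩
      show TE L _ _
      apply TE.of_fin
      intro n g
      have hfin : ∃ G ∈ ch, ∀ i, ∀ p, g i = Sum.inr p → p.1 ∈ G := by
        have := hchain.directedOn
        have hF : ∀ i, ∃ G ∈ ch, ∀ p, g i = Sum.inr p → p.1 ∈ G := by
          intro i
          rcases hgi : g i with j | j
          · obtain ⟨G, hG⟩ := hne
            exact ⟨G, hG, by simp⟩
          · obtain ⟨G, hG, hj⟩ := j.2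
            refine ⟨G, hG, fun p hp => ?_⟩
            cases hp; exact hj
        choose F hF1 hF2 using hF
        obtain ⟨G, hG, hG2⟩ : ∃ G ∈ ch, ∀ i, F i ⊆ G := by
          have hd : Directed (· ⊆ ·) (fun x : ch => (x : Set (ι' × N))) := this.directed_val
          have : Nonempty ch := hne.to_subtype
          obtain ⟨z, hz⟩ := hd.finite_le (fun i : Fin n => (⟨F i, hF1 i⟩ : ch))
          exact ⟨z.1, z.2, hz⟩
        exact ⟨G, hG, fun i p hp => hG2 i (hF2 i p hp)⟩
      obtain ⟨G, hG, hG2⟩ := hfin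
      have hTE : TE L _ _ := hch hG
      have : ∀ i, ∃ j : ι ⊕ G, Sum.map id (Subtype.val) (g i) = Sum.map id (Subtype.val) j := by
        intro i
        rcases hgi : g i with j | j
        · exact ⟨Sum.inl j, rfl⟩
        · exact ⟨Sum.inr ⟨j.1, hG2 i j hgi⟩, rfl⟩
      choose g' hg' using this
      have h1 := hTE.comp g'
      convert h1 using 1
      · funext i
        have := congrArg (Sum.elim s (fun p : ι' × N => c p.1)) (hg' i)
        simpa [Sum.elim_map, Function.comp_def] using this
      · funext i
        have := congrArg (Sum.elim t (fun p : ι' × N => p.2)) (hg' i)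
        simpa [Sum.elim_map, Function.comp_def] using this
  have hG : TE L _ _ := hGmax.prop
  have hinj : Function.Injective (fun p : G => p.1.1) := by
    intro p q hpq
    have h1 := (hG.eq_iff (Sum.inr p) (Sum.inr q)).1 (by simp at hpq ⊢; rw [hpq])
    simp at h1
    exact Subtype.ext (Prod.ext hpq h1)
  have hall : ∀ i : ι', ∃ y, (i, y) ∈ G := by
    intro i
    have hsm : #(range (Sum.elim t (fun p : G => p.1.2))) < κ := by
      rw [Sum.elim_range]
      refine (mk_union_le _ _).trans_lt (add_lt_of_lt hκ ht ?_)
      exact (mk_range_le.trans (mk_le_of_injective hinj)).trans_lt hι'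
    obtain ⟨y, hy⟩ := ext_one hN hG hsm (c i)
    refine ⟨y, ?_⟩
    have hmem : insert (i, y) G ∈ Q := by
      show TE L _ _
      classical
      let g : ι ⊕ (insert (i, y) G : Set (ι' × N)) → (ι ⊕ G) ⊕ Fin 1 :=
        Sum.elim (fun j => Sum.inl (Sum.inl j))
          (fun p => if hp : p.1 ∈ G then Sum.inl (Sum.inr ⟨p.1, hp⟩) else Sum.inr 0)
      have h1 := hy.comp g
      have aux : ∀ p : (insert (i, y) G : Set (ι' × N)), p.1 ∉ G → p.1 = (i, y) := by
        intro p hp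
        rcases p.2 with h | h
        · exact h
        · exact absurd h hp
      convert h1 using 1
      · funext j
        rcases j with j | p
        · rfl
        · by_cases hp : p.1 ∈ G
          · simp [g, hp]
          · have := aux p hp
            simp only [Function.comp, g, Sum.elim_inr, hp, dite_false]
            rw [this]
      · funext j
        rcases j with j | p
        · rfl
        · by_cases hp : p.1 ∈ G
          · simp [g, hp]
          · have := aux p hp
            simp only [Function.comp, g, Sum.elim_inr, hp, dite_false]
            rw [this]
    exact hGmax.le_of_ge hmem (subset_insert _ _) (mem_insert _ _)
  choose c' hc' using hall
  refine ⟨c', ?_⟩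
  have h1 := hG.comp (Sum.map id (fun i => (⟨(i, c' i), hc' i⟩ : G)))
  convert h1 using 1 <;> funext j <;> rcases j with j | j <;> rfl

theorem ext_fin {κ : Cardinal.{w}} (hκ : ℵ₀ ≤ κ) (hN : IsSat (L := L) N κ) {s : ι → M} {t : ι → N}
    (h : TE L s t) (ht : #(range t) < κ) {n : ℕ} (c : Fin n → M) :
    ∃ c' : Fin n → N, TE L (Sum.elim s c) (Sum.elim t c') := by
  obtain ⟨c', hc'⟩ := ext_many hκ hN h ht (ι' := ULift.{w} (Fin n))
    ((lt_aleph0_of_finite _).trans_le hκ) (fun i => c i.down)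
  refine ⟨fun i => c' ⟨i⟩, ?_⟩
  have h1 := hc'.comp (Sum.map id (fun i => (⟨i⟩ : ULift.{w} (Fin n))))
  convert h1 using 1 <;> funext j <;> rcases j with j | j <;> rfl

end Ext

/-- compactness in a saturated structure via ultraproducts -/
theorem compact {N : Type w} [L.Structure N] [Nonempty N] {κ : Cardinal.{w}} (hκ : ℵ₀ ≤ κ)
    (hN : IsSat (L := L) N κ) {n : ℕ} (U : Ultrafilter (Fin n → N)) (D : Set N) (hD : #D < κ) :
    ∃ a : Fin n → N, ∀ X, D.Definable L X → (a ∈ X ↔ X ∈ U) := by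
  let M := (U : Filter (Fin n → N)).Product (fun _ => N)
  let sD : D → M := fun d => ((fun _ => (d : N)) : (Fin n → N) → N)
  let c : Fin n → M := fun i => ((fun a => a i) : (Fin n → N) → N)
  have los : ∀ φ : L.Formula (D ⊕ Fin n), φ.Realize (Sum.elim sD c) ↔
      {a | φ.Realize (Sum.elim (fun d : D => (d : N)) a)} ∈ U := by
    intro φ
    have := Ultraproduct.realize_formula_cast (u := U) (M := fun _ => N) φ
      (Sum.elim (fun d _ => (d : N)) (fun i a => a i))
    have e : (fun i => ((Sum.elim (fun (d : D) (_ : Fin n → N) => (d : N)) (fun i a => a i) i : (Fin n → N) → N) : M))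
      = Sum.elim sD c := by
      funext i; rcases i with i | i <;> rfl
    rw [← e]
    refine this.trans ?_
    have e2 : ∀ a : Fin n → N, (fun i => Sum.elim (fun (d : D) (_ : Fin n → N) => (d : N)) (fun i a => a i) i a) = Sum.elim (fun d : D => (d : N)) a := by
      intro a; funext i; rcases i with i | i <;> rfl
    simp only [e2]
    rfl
  have hTE : TE L sD (fun d : D => (d : N)) := by
    intro φ
    have h1 := los (φ.relabel Sum.inl)
    simp only [Formula.realize_relabel, Sum.elim_comp_inl] at h1
    rw [h1]
    by_cases hφ : φ.Realize (fun d : D => (d : N)) <;> simp [hφ]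
    exact Filter.univ_mem
  obtain ⟨a, ha⟩ := ext_fin hκ hN hTE (by simpa using hD) c
  refine ⟨a, ?_⟩
  intro X hX
  obtain ⟨φ, rfl⟩ := (def_set D X).1 hX
  rw [← los φ, ha φ]
  rfl
end Paper

namespace Paper
variable {L : FirstOrder.Language.{u, v}}

/-- semantic version of Morley rank at least `α` -/
def RGe (L : FirstOrder.Language.{u, v}) {N : Type w} [L.Structure N] {n : ℕ}
    (X : Set (Fin n → N)) (α : Ordinal.{0}) : Prop :=
  X.Nonempty ∧ ∀ β < α, ∃ Y : ℕ → Set (Fin n → N),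
    (∀ i, (univ : Set N).Definable L (Y i)) ∧ (∀ i, Y i ⊆ X) ∧
    (∀ i j, i ≠ j → Disjoint (Y i) (Y j)) ∧ ∀ i, RGe L (Y i) β
termination_by α
decreasing_by exact ‹_ < α›

/-- genericity: every `A`-definable set containing `a` has rank at least `α` -/
def Gn (L : FirstOrder.Language.{u, v}) {N : Type w} [L.Structure N] (A : Set N) {n : ℕ}
    (a : Fin n → N) (α : Ordinal.{0}) : Prop :=
  ∀ X, A.Definable L X → a ∈ X → RGe L X α

section Rank
variable {N : Type w} [L.Structure N] {n : ℕ}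

theorem def_univ (X : Set (Fin n → N)) : (univ : Set N).Definable L X ↔
    ∃ φ : L.Formula (N ⊕ Fin n), X = {a | RealP φ a} := by
  have := def_range (L := L) (id : N → N) X
  rw [range_id] at this
  exact this

theorem mrge_iff (α : Ordinal.{0}) : ∀ φ : L.Formula (N ⊕ Fin n),
    MRGe φ α ↔ RGe L {a | RealP φ a} α := by
  induction α using WellFoundedLT.induction with
  | ind α ih =>
  intro φ
  rw [MRGe, RGe]
  refine and_congr Iff.rfl (forall₂_congr fun β hβ => ?_)
  constructor
  · rintro ⟨ψ, h1, h2, h3⟩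
    refine ⟨fun i => {a | RealP (ψ i) a}, fun i => (def_univ _).2 ⟨ψ i, rfl⟩, fun i a ha => h1 i a ha,
      fun i j hij => ?_, fun i => (ih β hβ _).1 (h3 i)⟩
    rw [Set.disjoint_left]
    exact fun a ha hb => h2 i j hij a ⟨ha, hb⟩
  · rintro ⟨Y, h0, h1, h2, h3⟩
    choose ψ hψ using fun i => (def_univ _).1 (h0 i)
    refine ⟨ψ, ?_, ?_, ?_⟩
    · intro i a ha
      exact h1 i (by rw [hψ i]; exact ha)
    · rintro i j hij a ⟨ha, hb⟩
      have := h2 i j hij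
      rw [Set.disjoint_left, hψ i, hψ j] at this
      exact this ha hb
    · intro i
      rw [ih β hβ, ← hψ i]
      exact h3 i

theorem tprk_iff (A : Set N) (a : Fin n → N) (α : Ordinal.{0}) :
    TpRkGe (L := L) A a α ↔ Gn L A a α := by
  have key : ∀ φ : L.Formula (A ⊕ Fin n), {x | RealP (φ.relabel (Sum.map (fun x : ↥A => (x : N)) id)) x}
      = {x | φ.Realize (Sum.elim (fun a : A => (a : N)) x)} := by
    intro φ; ext x
    simp only [RealP, mem_ofPred_eq, Formula.realize_relabel]
    have : (Sum.elim id x ∘ Sum.map (fun a : A => (a : N)) id) = Sum.elim (fun a : A => (a : N)) x := by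
      funext i; rcases i with i | i <;> rfl
    rw [this]
  constructor
  · intro h X hX ha
    obtain ⟨φ, rfl⟩ := (def_set A X).1 hX
    have := (mrge_iff α _).1 (h φ ha)
    rwa [key] at this
  · intro h φ hφ
    rw [mrge_iff, key]
    exact h _ ((def_set A _).2 ⟨φ, rfl⟩) hφ

theorem RGe.nonempty {X : Set (Fin n → N)} {α} (h : RGe L X α) : X.Nonempty := by
  rw [RGe] at h; exact h.1

theorem RGe.mono {X Y : Set (Fin n → N)} {α} (h : RGe L X α) (hXY : X ⊆ Y) : RGe L Y α := by
  rw [RGe] at h ⊢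
  refine ⟨h.1.mono hXY, fun β hβ => ?_⟩
  obtain ⟨Z, h1, h2, h3⟩ := h.2 β hβ
  exact ⟨Z, h1, fun i => (h2 i).trans hXY, h3⟩

theorem RGe.anti {X : Set (Fin n → N)} {α β} (h : RGe L X α) (hβ : β ≤ α) : RGe L X β := by
  rw [RGe] at h ⊢
  exact ⟨h.1, fun γ hγ => h.2 γ (hγ.trans_le hβ)⟩

theorem rge_zero {X : Set (Fin n → N)} : RGe L X 0 ↔ X.Nonempty := by
  rw [RGe]
  exact ⟨fun h => h.1, fun h => ⟨h, fun β hβ => absurd hβ not_lt_zero⟩⟩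

theorem RGe.union (α : Ordinal.{0}) : ∀ {X Y : Set (Fin n → N)}, (univ : Set N).Definable L X →
    (univ : Set N).Definable L Y → RGe L (X ∪ Y) α → RGe L X α ∨ RGe L Y α := by
  induction α using WellFoundedLT.induction with
  | ind α ih =>
  intro X Y hX hY h
  rcases X.eq_empty_or_nonempty with rfl | hXne
  · rw [empty_union] at h; exact Or.inr h
  rcases Y.eq_empty_or_nonempty with rfl | hYne
  · rw [union_empty] at h; exact Or.inl h
  by_contra hcon
  push Not at hcon
  obtain ⟨hx, hy⟩ := hcon
  rw [RGe] at hx hy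
  push Not at hx hy
  obtain ⟨β, hβ, hβ'⟩ := hx hXne
  obtain ⟨γ, hγ, hγ'⟩ := hy hYne
  rw [RGe] at h
  obtain ⟨Z, h1, h2, h3, h4⟩ := h.2 (max β γ) (max_lt hβ hγ)
  have hsplit : ∀ i, RGe L (Z i ∩ X) (max β γ) ∨ RGe L (Z i ∩ Y) (max β γ) := by
    intro i
    refine ih _ (max_lt hβ hγ) ((h1 i).inter hX) ((h1 i).inter hY) ((h4 i).mono ?_)
    intro a ha
    rcases h2 i ha with h | h
    · exact Or.inl ⟨ha, h⟩
    · exact Or.inr ⟨ha, h⟩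
  have hinf : {i | RGe L (Z i ∩ X) (max β γ)}.Infinite ∨ {i | RGe L (Z i ∩ Y) (max β γ)}.Infinite := by
    rw [← Set.infinite_union]
    have : {i | RGe L (Z i ∩ X) (max β γ)} ∪ {i | RGe L (Z i ∩ Y) (max β γ)} = (Set.univ : Set ℕ) :=
      eq_univ_of_forall hsplit
    rw [this]
    exact infinite_univ
  rcases hinf with hinf | hinf
  · let f := hinf.natEmbedding
    obtain ⟨i, hi⟩ := hβ' (fun i => Z (f i) ∩ X) (fun i => (h1 _).inter hX) (fun i => inter_subset_right)
      (fun i j hij => (h3 _ _ (fun h => hij (f.injective (Subtype.ext h)))).mono inter_subset_left inter_subset_left)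
    exact hi ((f i).2.anti (le_max_left _ _))
  · let f := hinf.natEmbedding
    obtain ⟨i, hi⟩ := hγ' (fun i => Z (f i) ∩ Y) (fun i => (h1 _).inter hY) (fun i => inter_subset_right)
      (fun i j hij => (h3 _ _ (fun h => hij (f.injective (Subtype.ext h)))).mono inter_subset_left inter_subset_left)
    exact hi ((f i).2.anti (le_max_right _ _))

theorem split_seq (P : Set (Fin n → N) → Prop) (β : Ordinal.{0})
    (hP : ∀ X, (univ : Set N).Definable L X → P X → ∃ Y ⊆ X, (univ : Set N).Definable L Y ∧ P Y ∧
      RGe L (X \ Y) β) (X : Set (Fin n → N)) (hX : (univ : Set N).Definable L X) (hPX : P X) :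
    ∃ Y : ℕ → Set (Fin n → N),
    (∀ i, (univ : Set N).Definable L (Y i)) ∧ (∀ i, Y i ⊆ X) ∧
    (∀ i j, i ≠ j → Disjoint (Y i) (Y j)) ∧ ∀ i, RGe L (Y i) β := by
  choose! F h1 h2 h3 h4 using hP
  let G : ℕ → Set (Fin n → N) := fun k => F^[k] X
  have hG : ∀ k, (univ : Set N).Definable L (G k) ∧ P (G k) := by
    intro k
    induction k with
    | zero => exact ⟨hX, hPX⟩
    | succ k ih =>
      simp only [G, Function.iterate_succ', Function.comp] at ih ⊢
      exact ⟨h2 _ ih.1 ih.2, h3 _ ih.1 ih.2⟩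
  have hs : ∀ k, G (k + 1) = F (G k) := fun k => by
    simp only [G, Function.iterate_succ', Function.comp]
  have hanti : Antitone G := antitone_nat_of_succ_le fun k => by
    rw [hs]; exact h1 _ (hG k).1 (hG k).2
  refine ⟨fun k => G k \ G (k + 1), fun k => (hG _).1.sdiff (hG _).1, fun k => ?_, ?_, ?_⟩
  · exact Set.sdiff_subset.trans (hanti (Nat.zero_le k))
  · have : ∀ i j, i < j → Disjoint (G i \ G (i + 1)) (G j \ G (j + 1)) := by
      intro i j hij
      rw [Set.disjoint_left]
      intro a ha hb
      exact ha.2 (hanti hij hb.1)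
    intro i j hij
    rcases lt_or_gt_of_ne hij with h | h
    · exact this i j h
    · exact (this j i h).symm
  · intro k
    show RGe L (G k \ G (k + 1)) β
    rw [hs]; exact h4 _ (hG k).1 (hG k).2

theorem def_singleton (a : Fin n → N) : (univ : Set N).Definable L ({a} : Set (Fin n → N)) := by
  have : ({a} : Set (Fin n → N)) = ⋂ i, {x | x i = a i} := by
    ext x; simp [funext_iff]
  rw [this]
  apply definable_iInter_of_finite
  intro i
  rw [def_univ]
  refine ⟨(Term.var (Sum.inr i)).equal (Term.var (Sum.inl (a i))), ?_⟩
  ext x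
  simp [RealP, Formula.realize_equal]

theorem rge_one_of_infinite {X : Set (Fin n → N)} (hX : X.Infinite) : RGe L X 1 := by
  rw [RGe]
  refine ⟨hX.nonempty, fun β hβ => ?_⟩
  rw [Order.lt_one_iff] at hβ
  subst hβ
  let f := hX.natEmbedding
  refine ⟨fun i => {(f i).1}, fun i => def_singleton _, fun i => by simp, fun i j hij => ?_, fun i => ?_⟩
  · simp only [disjoint_singleton]
    exact fun h => hij (f.injective (Subtype.ext h))
  · rw [rge_zero]; simp

theorem not_rge_one_of_finite {X : Set (Fin n → N)} (hX : X.Finite) : ¬ RGe L X 1 := by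
  intro h
  rw [RGe] at h
  obtain ⟨Y, h1, h2, h3, h4⟩ := h.2 0 zero_lt_one
  choose y hy using fun i => (h4 i).nonempty
  have : Function.Injective y := by
    intro i j hij
    by_contra hne
    exact Set.disjoint_left.1 (h3 i j hne) (hy i) (hij ▸ hy j)
  exact (infinite_range_of_injective this) (hX.subset (range_subset_iff.2 fun i => h2 i (hy i)))

theorem Gn.anti_set {A B : Set N} {a : Fin n → N} {α} (h : Gn L B a α) (hAB : A ⊆ B) : Gn L A a α :=
  fun X hX ha => h X (hX.mono hAB) ha
theorem Gn.anti {A : Set N} {a : Fin n → N} {α β} (h : Gn L A a α) (hb : β ≤ α) : Gn L A a β :=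
  fun X hX ha => (h X hX ha).anti hb

theorem indep_iff (A : Set N) (a : Fin n → N) (B : Set N) :
    Indep (L := L) A a B ↔ ∀ α, Gn L A a α → Gn L (A ∪ B) a α := by
  simp only [Indep, tprk_iff]
  exact forall_congr' fun α => ⟨fun h => h.2, fun h => ⟨fun h' => h'.anti_set subset_union_left, h⟩⟩

/-- invariance of rank -/
theorem rge_inv (hN : IsSat (L := L) N #N) (hbig : ℵ₁ < #N) (α : Ordinal.{0}) :
    ∀ {ι : Type w} {s t : ι → N} (_ : TE L s t) (_ : #(range t) < #N) (φ : L.Formula (ι ⊕ Fin n)),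
    RGe L {x | φ.Realize (Sum.elim s x)} α → RGe L {x | φ.Realize (Sum.elim t x)} α := by
  have hinf : ℵ₀ ≤ #N := (aleph0_le_aleph 1).trans hbig.le
  induction α using WellFoundedLT.induction with
  | ind α ih =>
  intro ι s t hTE ht φ h
  rw [RGe] at h ⊢
  refine ⟨(hTE.ex φ).1 h.1, fun β hβ => ?_⟩
  obtain ⟨Y, h0, h1, h2, h3⟩ := h.2 β hβ
  choose P hP hPY using fun i => (definable_iff_finitely_definable.1 (h0 i))
  let Q : Set N := ⋃ i, (P i : Set N)
  have hQ : Q.Countable := countable_iUnion fun i => (P i).countable_toSet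
  have hQY : ∀ i, Q.Definable L (Y i) := fun i => (hPY i).mono (subset_iUnion (fun i => (P i : Set N)) i)
  choose ψ hψ using fun i => (def_set _ _).1 (hQY i)
  have hQc : #Q < #N := (Cardinal.le_aleph0_iff_set_countable.2 hQ).trans_lt ((aleph0_lt_aleph_one).trans hbig)
  obtain ⟨c', hc'⟩ := ext_many hinf hN hTE ht hQc (fun q : Q => (q : N))
  let ψ' : ℕ → L.Formula ((ι ⊕ Q) ⊕ Fin n) := fun i => (ψ i).relabel (Sum.map Sum.inr id)
  let φ' : L.Formula ((ι ⊕ Q) ⊕ Fin n) := φ.relabel (Sum.map Sum.inl id)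
  have e1 : ∀ (a : ι → N) (b : Q → N) (x : Fin n → N) i, (ψ' i).Realize (Sum.elim (Sum.elim a b) x) ↔
      (ψ i).Realize (Sum.elim b x) := by
    intro a b x i
    simp only [ψ', Formula.realize_relabel]
    have : Sum.elim (Sum.elim a b) x ∘ Sum.map Sum.inr id = Sum.elim b x := by
      funext j; rcases j with j | j <;> rfl
    rw [this]
  have e2 : ∀ (a : ι → N) (b : Q → N) (x : Fin n → N), φ'.Realize (Sum.elim (Sum.elim a b) x) ↔
      φ.Realize (Sum.elim a x) := by
    intro a b x
    simp only [φ', Formula.realize_relabel]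
    have : Sum.elim (Sum.elim a b) x ∘ Sum.map Sum.inl id = Sum.elim a x := by
      funext j; rcases j with j | j <;> rfl
    rw [this]
  refine ⟨fun i => {x | (ψ i).Realize (Sum.elim c' x)}, fun i => ?_, fun i => ?_, fun i j hij => ?_, fun i => ?_⟩
  · exact ((def_range c' _).2 ⟨ψ i, rfl⟩).mono (subset_univ _)
  · have := (hc'.all ((ψ' i).imp φ')).1 (by
      intro x
      rw [Formula.realize_imp, e1, e2]
      intro hx
      exact h1 i (by rw [hψ i]; exact hx))
    intro x hx
    have := this x
    rw [Formula.realize_imp, e1, e2] at this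
    exact this hx
  · have := (hc'.all ((ψ' i ⊓ ψ' j).not)).1 (by
      intro x
      rw [Formula.realize_not, Formula.realize_inf, e1, e1]
      rintro ⟨ha, hb⟩
      have := h2 i j hij
      rw [Set.disjoint_left, hψ i, hψ j] at this
      exact this ha hb)
    rw [Set.disjoint_left]
    intro x ha hb
    have := this x
    rw [Formula.realize_not, Formula.realize_inf, e1, e1] at this
    exact this ⟨ha, hb⟩
  · have hr : #(range (Sum.elim t c')) < #N := by
      rw [Sum.elim_range]
      exact (mk_union_le _ _).trans_lt (add_lt_of_lt hinf ht (mk_range_le.trans_lt hQc))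
    have := ih β hβ hc' hr (ψ' i) (by
      simp only [e1]
      have := h3 i
      rw [hψ i] at this
      exact this)
    simpa only [e1] using this

theorem gn_inv (hN : IsSat (L := L) N #N) (hbig : ℵ₁ < #N) {α : Ordinal.{0}} 
    {ι : Type w} {s t : ι → N} {a b : Fin n → N} (hTE : TE L (Sum.elim s a) (Sum.elim t b))
    (ht : #(range t) < #N) (h : Gn L (range s) a α) : Gn L (range t) b α := by
  intro X hX hb
  obtain ⟨φ, rfl⟩ := (def_range t X).1 hX
  apply rge_inv hN hbig α (hTE.comp Sum.inl) (by simpa using ht)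
  exact h _ ((def_range s _).2 ⟨φ, rfl⟩) ((hTE φ).2 hb)

/-- existence of generic points -/
theorem gen (hN : IsSat (L := L) N #N) (hbig : ℵ₁ < #N) (D : Set N) (hD : #D < #N) (α : Ordinal.{0})
    (F : Set (Set (Fin n → N))) (hne : F.Nonempty) (hinter : ∀ X ∈ F, ∀ Y ∈ F, X ∩ Y ∈ F)
    (hF : ∀ X ∈ F, RGe L X α) (hFD : ∀ X ∈ F, D.Definable L X) :
    ∃ a : Fin n → N, (∀ X ∈ F, a ∈ X) ∧ Gn L D a α := by
  have hinf : ℵ₀ ≤ #N := (aleph0_le_aleph 1).trans hbig.le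
  have : Nonempty N := by
    rw [← mk_ne_zero_iff]
    exact (aleph0_pos.trans_le hinf).ne'
  let G : Filter (Fin n → N) :=
    { sets := {S | ∃ X ∈ F, ∃ Y, (univ : Set N).Definable L Y ∧ ¬ RGe L Y α ∧ X \ Y ⊆ S}
      univ_sets := by
        obtain ⟨X, hX⟩ := hne
        exact ⟨X, hX, ∅, definable_empty, fun h => by simpa using h.nonempty, subset_univ _⟩
      sets_of_superset := by
        rintro S S' ⟨X, hX, Y, hY, hY', h⟩ hS
        exact ⟨X, hX, Y, hY, hY', h.trans hS⟩
      inter_sets := by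
        rintro S S' ⟨X, hX, Y, hY, hY', h⟩ ⟨X', hX', Z, hZ, hZ', h'⟩
        refine ⟨X ∩ X', hinter _ hX _ hX', Y ∪ Z, hY.union hZ, fun hr => ?_, ?_⟩
        · rcases RGe.union α hY hZ hr with hr | hr
          · exact hY' hr
          · exact hZ' hr
        · rintro a ⟨⟨ha, ha'⟩, hb⟩
          exact ⟨h ⟨ha, fun h => hb (Or.inl h)⟩, h' ⟨ha', fun h => hb (Or.inr h)⟩⟩ }
  have hG : G.NeBot := by
    rw [Filter.neBot_iff]
    intro hbot
    have : (∅ : Set (Fin n → N)) ∈ G := by rw [hbot]; exact Filter.mem_bot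
    obtain ⟨X, hX, Y, hY, hY', h⟩ := this
    exact hY' ((hF X hX).mono (by
      intro a ha
      by_contra hc
      exact h ⟨ha, hc⟩))
  obtain ⟨a, ha⟩ := compact hinf hN (Ultrafilter.of G) D hD
  refine ⟨a, fun X hX => ?_, fun X hX haX => ?_⟩
  · rw [ha X (hFD X hX)]
    exact Ultrafilter.of_le G ⟨X, hX, ∅, definable_empty, fun h => by simpa using h.nonempty, by simp⟩
  · by_contra hc
    have h1 : Xᶜ ∈ Ultrafilter.of G := by
      apply Ultrafilter.of_le G
      obtain ⟨Z, hZ⟩ := hne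
      exact ⟨Z, hZ, X, hX.mono (subset_univ _), hc, fun y hy => hy.2⟩
    rw [ha X hX] at haX
    exact Ultrafilter.compl_notMem_iff.2 haX h1
end Rank
end Paper

namespace Paper
variable {L : FirstOrder.Language.{u, v}}

/-- same type over a set, for arbitrary tuples -/
def TA (L : FirstOrder.Language.{u, v}) {N : Type*} [L.Structure N] (A : Set N) {κ : Type*}
    (a b : κ → N) : Prop :=
  TE L (Sum.elim (fun x : A => (x : N)) a) (Sum.elim (fun x : A => (x : N)) b)

section TA
variable {N : Type w} [L.Structure N] {A B : Set N} {κ κ' : Type*}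

theorem TA.refl (a : κ → N) : TA L A a a := TE.refl _
theorem TA.symm {a b : κ → N} (h : TA L A a b) : TA L A b a := TE.symm h
theorem TA.trans {a b c : κ → N} (h : TA L A a b) (h' : TA L A b c) : TA L A a c := TE.trans h h'
theorem TA.mono {a b : κ → N} (h : TA L B a b) (hAB : A ⊆ B) : TA L A a b := by
  have := TE.comp h (Sum.map (Set.inclusion hAB) id)
  show TE L _ _
  convert this using 1 <;> funext i <;> rcases i with i | i <;> rfl
theorem TA.comp {a b : κ → N} (h : TA L A a b) (g : κ' → κ) : TA L A (a ∘ g) (b ∘ g) := by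
  have := TE.comp h (Sum.map id g)
  show TE L _ _
  convert this using 1 <;> funext i <;> rcases i with i | i <;> rfl
theorem TA.mem {a b : κ → N} (h : TA L A a b) {X : Set (κ → N)} (hX : A.Definable L X) :
    a ∈ X ↔ b ∈ X := by
  obtain ⟨φ, rfl⟩ := (def_set A X).1 hX
  exact h φ
theorem TA.of_mem {a b : κ → N} (h : ∀ X, A.Definable L X → a ∈ X → b ∈ X) : TA L A a b := by
  intro φ
  refine ⟨fun hφ => h _ ((def_set A _).2 ⟨φ, rfl⟩) hφ, fun hφ => ?_⟩
  by_contra hc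
  have := h _ ((def_set A _).2 ⟨φ.not, rfl⟩) (by simpa using hc)
  simp only [mem_ofPred_eq, Formula.realize_not] at this
  exact this hφ

/-- moving a tuple to the parameters -/
theorem TA.shift {a : κ → N} {c d : κ' → N} (h : TA L A (Sum.elim a c) (Sum.elim a d)) :
    TA L (A ∪ range a) c d := by
  classical
  have hx : ∀ x : (A ∪ range a : Set N), ∃ y : A ⊕ κ, Sum.elim (fun x : A => (x : N)) a y = x := by
    rintro ⟨x, hx | ⟨i, rfl⟩⟩
    · exact ⟨Sum.inl ⟨x, hx⟩, rfl⟩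
    · exact ⟨Sum.inr i, rfl⟩
  choose g hg using hx
  have := TE.comp h (Sum.elim (fun x => Sum.elim Sum.inl (fun i => Sum.inr (Sum.inl i)) (g x))
    (fun i => Sum.inr (Sum.inr i)))
  show TE L _ _
  convert this using 1 <;>
  · funext i
    rcases i with i | i
    · have := hg i
      simp only [Function.comp, Sum.elim_inl]
      rcases hgi : g i with y | y <;> rw [hgi] at this <;> simp at this ⊢ <;> exact this.symm
    · rfl
theorem TA.unshift {a : κ → N} {c d : κ' → N} (h : TA L (A ∪ range a) c d) :
    TA L A (Sum.elim a c) (Sum.elim a d) := by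
  have := TE.comp h (Sum.elim (fun x : A => Sum.inl ⟨x, Or.inl x.2⟩)
    (Sum.elim (fun i => Sum.inl ⟨a i, Or.inr ⟨i, rfl⟩⟩) (fun i => Sum.inr i)))
  show TE L _ _
  convert this using 1 <;>
  · funext i
    rcases i with i | i | i <;> rfl
theorem TA.swap {a b : κ → N} {c d : κ' → N} (h : TA L A (Sum.elim a c) (Sum.elim b d)) :
    TA L A (Sum.elim c a) (Sum.elim d b) := by
  have := h.comp (Sum.swap)
  convert this using 1 <;> funext i <;> rcases i with i | i <;> rfl
theorem TA.left {a b : κ → N} {c d : κ' → N} (h : TA L A (Sum.elim a c) (Sum.elim b d)) :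
    TA L A a b := h.comp Sum.inl
theorem TA.right {a b : κ → N} {c d : κ' → N} (h : TA L A (Sum.elim a c) (Sum.elim b d)) :
    TA L A c d := h.comp Sum.inr
end TA

/-- standing hypotheses on the monster model -/
structure Mon (L : FirstOrder.Language.{u, v}) (N : Type w) [L.Structure N] : Prop where
  sat : IsSat (L := L) N #N
  big : ℵ₁ < #N

/-- total transcendence -/
def TTr (L : FirstOrder.Language.{u, v}) (N : Type w) [L.Structure N] : Prop :=
  ∀ (n : ℕ) (X : Set (Fin n → N)), (univ : Set N).Definable L X → ∃ α, ¬ RGe L X α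

section Mon
variable {N : Type w} [L.Structure N] {A B : Set N}

theorem Mon.inf (m : Mon L N) : ℵ₀ ≤ #N := (aleph0_le_aleph 1).trans m.big.le
theorem Mon.union (m : Mon L N) (hA : #A < #N) (hB : #B < #N) : #(A ∪ B : Set N) < #N :=
  (mk_union_le _ _).trans_lt (add_lt_of_lt m.inf hA hB)
theorem Mon.ctbl (m : Mon L N) (hA : A.Countable) : #A < #N :=
  (Cardinal.le_aleph0_iff_set_countable.2 hA).trans_lt ((aleph0_lt_aleph_one).trans m.big)
theorem Mon.fin (m : Mon L N) (hA : A.Finite) : #A < #N := m.ctbl hA.countable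
theorem Mon.rng (m : Mon L N) {n : ℕ} (a : Fin n → N) : #(range a) < #N := m.fin (finite_range a)

theorem Mon.ext (m : Mon L N) (hA : #A < #N) {κ : Type} [Finite κ] {a b : κ → N}
    (h : TA L A a b) {n : ℕ} (c : Fin n → N) :
    ∃ d : Fin n → N, TA L A (Sum.elim a c) (Sum.elim b d) := by
  obtain ⟨d, hd⟩ := ext_fin m.inf m.sat h (by
    rw [Sum.elim_range, Subtype.range_coe]
    exact m.union hA (m.fin (finite_range b))) c
  refine ⟨d, ?_⟩
  have := TE.comp hd (Sum.elim (fun x => Sum.inl (Sum.inl x))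
    (Sum.elim (fun i => Sum.inl (Sum.inr i)) (fun i => Sum.inr i)))
  show TE L _ _
  convert this using 1 <;>
  · funext i
    rcases i with i | i | i <;> rfl

theorem Mon.gn (m : Mon L N) (hA : #A < #N) {κ : Type} [Finite κ] {a b : κ → N} {n : ℕ}
    {c d : Fin n → N} (h : TA L A (Sum.elim a c) (Sum.elim b d)) {α}
    (hg : Gn L (A ∪ range a) c α) : Gn L (A ∪ range b) d α := by
  have h1 : TE L (Sum.elim (Sum.elim (fun x : A => (x : N)) a) c)
    (Sum.elim (Sum.elim (fun x : A => (x : N)) b) d) := by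
    have := TE.comp h (Sum.elim (Sum.elim (fun x => Sum.inl x)
    (fun i => Sum.inr (Sum.inl i))) (fun i => Sum.inr (Sum.inr i)))
    convert this using 1 <;>
    · funext i
      rcases i with (i | i) | i <;> rfl
  have h2 := gn_inv m.sat m.big (α := α) h1 (by
    rw [Sum.elim_range, Subtype.range_coe]
    exact m.union hA (m.fin (finite_range b))) (by
    rw [Sum.elim_range, Subtype.range_coe]
    exact hg)
  rwa [Sum.elim_range, Subtype.range_coe] at h2

theorem Mon.gn0 (m : Mon L N) {n : ℕ}
    {c d : Fin n → N} (h : TA L A c d) {α}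
    (hg : Gn L A c α) : Gn L A d α := by
  intro X hX hd
  exact hg X hX ((h.mem hX).2 hd)

theorem rge_succ {n : ℕ} {X : Set (Fin n → N)} {α : Ordinal.{0}} (Y : ℕ → Set (Fin n → N))
    (h1 : ∀ i, (univ : Set N).Definable L (Y i)) (h2 : ∀ i, Y i ⊆ X)
    (h3 : ∀ i j, i ≠ j → Disjoint (Y i) (Y j)) (h4 : ∀ i, RGe L (Y i) α) : RGe L X (α + 1) := by
  rw [RGe]
  refine ⟨((h4 0).nonempty).mono (h2 0), fun β hβ => ⟨Y, h1, h2, h3, fun i => (h4 i).anti ?_⟩⟩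
  exact Order.lt_add_one_iff.1 hβ

theorem rank_ex (tt : TTr L N) (A : Set N) {n : ℕ} (a : Fin n → N) :
    ∃ (α : Ordinal.{0}) (X : Set (Fin n → N)), A.Definable L X ∧ a ∈ X ∧ Gn L A a α ∧
      ¬ RGe L X (α + 1) := by
  have hne : {γ | ¬ Gn L A a γ}.Nonempty := by
    obtain ⟨γ, hγ⟩ := tt n univ definable_univ
    exact ⟨γ, fun h => hγ (h univ definable_univ (mem_univ _))⟩
  let γ := sInf {γ | ¬ Gn L A a γ}
  have hγ : ¬ Gn L A a γ := csInf_mem hne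
  have hlt : ∀ β < γ, Gn L A a β := fun β hβ => by
    by_contra hc
    exact notMem_of_lt_csInf' hβ hc
  unfold Gn at hγ
  push Not at hγ
  obtain ⟨X, hX, ha, hr⟩ := hγ
  by_contra hcon
  push Not at hcon
  apply hr
  rw [RGe]
  refine ⟨⟨a, ha⟩, fun β hβ => ?_⟩
  have := hcon β X hX ha (hlt β hβ)
  rw [RGe] at this
  exact this.2 β (Order.lt_add_one_iff.2 le_rfl)

theorem gn_all {n : ℕ} {a : Fin n → N} {X : Set (Fin n → N)} {α : Ordinal.{0}} (hX : A.Definable L X)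
    (ha : a ∈ X) (hr : ¬ RGe L X (α + 1)) (hB : Gn L B a α) {β} (h : Gn L A a β) : Gn L B a β := by
  refine hB.anti ?_
  by_contra hc
  exact hr ((h X hX ha).anti (Order.add_one_le_of_lt (not_le.1 hc)))

/-- independence written with generic points -/
def Ind (L : FirstOrder.Language.{u, v}) {N : Type w} [L.Structure N] (A : Set N) {n : ℕ}
    (a : Fin n → N) (D : Set N) : Prop := ∀ α, Gn L A a α → Gn L D a α

theorem Mon.nfe (m : Mon L N) (tt : TTr L N) {A D : Set N} (hAD : A ⊆ D) (hD : #D < #N) {n : ℕ}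
    (a : Fin n → N) : ∃ a' : Fin n → N, TA L A a a' ∧ Ind L A a' D := by
  obtain ⟨α, X, hX, haX, hg, hr⟩ := rank_ex tt A a
  obtain ⟨a', h1, h2⟩ := gen m.sat m.big D hD α {Y | A.Definable L Y ∧ a ∈ Y} ⟨X, hX, haX⟩
    (fun Y hY Z hZ => ⟨hY.1.inter hZ.1, hY.2, hZ.2⟩) (fun Y hY => hg Y hY.1 hY.2)
    (fun Y hY => hY.1.mono hAD)
  refine ⟨a', TA.of_mem fun Y hY ha => h1 Y ⟨hY, ha⟩, fun β hβ => ?_⟩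
  exact gn_all hX (h1 X ⟨hX, haX⟩) hr h2 hβ

/-- degree one -/
def Deg1 (L : FirstOrder.Language.{u, v}) {N : Type w} [L.Structure N] {n : ℕ}
    (X : Set (Fin n → N)) (α : Ordinal.{0}) : Prop :=
  RGe L X α ∧ ∀ Y, (univ : Set N).Definable L Y → ¬ (RGe L (X ∩ Y) α ∧ RGe L (X \ Y) α)

theorem Deg1.uniq {n : ℕ} {Z : Set (Fin n → N)} {α : Ordinal.{0}} (h : Deg1 L Z α)
    (hZ : A.Definable L Z) {a b : Fin n → N} (ha : a ∈ Z) (hb : b ∈ Z) (ga : Gn L A a α)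
    (gb : Gn L A b α) : TA L A a b := by
  apply TA.of_mem
  intro X hX haX
  by_contra hc
  exact h.2 X (hX.mono (subset_univ _)) ⟨ga _ (hZ.inter hX) ⟨ha, haX⟩, gb _ (hZ.sdiff hX) ⟨hb, hc⟩⟩

theorem Deg1.not_succ {n : ℕ} {Z : Set (Fin n → N)} {α : Ordinal.{0}} (h : Deg1 L Z α) :
    ¬ RGe L Z (α + 1) := by
  intro hr
  rw [RGe] at hr
  obtain ⟨Y, h1, h2, h3, h4⟩ := hr.2 α (Order.lt_add_one_iff.2 le_rfl)
  refine h.2 (Y 0) (h1 0) ⟨(h4 0).mono fun a ha => ⟨h2 0 ha, ha⟩, (h4 1).mono fun a ha => ⟨h2 1 ha, ?_⟩⟩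
  exact fun hc => Set.disjoint_left.1 (h3 0 1 (by simp)) hc ha

/-- decomposition into degree one sets -/
def Dec (L : FirstOrder.Language.{u, v}) {N : Type w} [L.Structure N] {n : ℕ}
    (X : Set (Fin n → N)) (α : Ordinal.{0}) (l : List (Set (Fin n → N))) : Prop :=
  (∀ Z ∈ l, (univ : Set N).Definable L Z ∧ Deg1 L Z α) ∧
  ∃ W, (univ : Set N).Definable L W ∧ ¬ RGe L W α ∧ ∀ x ∈ X, x ∈ W ∨ ∃ Z ∈ l, x ∈ Z

theorem Dec.union {n : ℕ} {X Y U : Set (Fin n → N)} {α : Ordinal.{0}} {l l'} (h : Dec L X α l)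
    (h' : Dec L Y α l') (hU : U ⊆ X ∪ Y) : Dec L U α (l ++ l') := by
  obtain ⟨h1, W, hW, hWr, h2⟩ := h
  obtain ⟨h1', W', hW', hWr', h2'⟩ := h'
  refine ⟨fun Z hZ => ?_, W ∪ W', hW.union hW', fun hr => ?_, fun x hx => ?_⟩
  · rcases List.mem_append.1 hZ with h | h
    · exact h1 Z h
    · exact h1' Z h
  · exact (RGe.union α hW hW' hr).elim hWr hWr'
  · rcases hU hx with h | h
    · rcases h2 x h with h | ⟨Z, hZ, h⟩
      · exact Or.inl (Or.inl h)
      · exact Or.inr ⟨Z, List.mem_append_left _ hZ, h⟩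
    · rcases h2' x h with h | ⟨Z, hZ, h⟩
      · exact Or.inl (Or.inr h)
      · exact Or.inr ⟨Z, List.mem_append_right _ hZ, h⟩

theorem dec_ex {n : ℕ} {X : Set (Fin n → N)} {α : Ordinal.{0}} (hX : (univ : Set N).Definable L X)
    (hr : ¬ RGe L X (α + 1)) : ∃ l, Dec L X α l := by
  by_contra hcon
  obtain ⟨Y, h1, h2, h3, h4⟩ := split_seq (fun X => ¬ ∃ l, Dec L X α l) α (by
    intro X hX hP
    have hXr : RGe L X α := by
      by_contra hc
      exact hP ⟨[], by simp, X, hX, hc, fun x hx => Or.inl hx⟩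
    have hnd : ¬ Deg1 L X α := fun hd => hP ⟨[X], by simpa using ⟨hX, hd⟩, ∅, definable_empty,
      fun h => by simpa using h.nonempty, fun x hx => Or.inr ⟨X, by simp, hx⟩⟩
    unfold Deg1 at hnd
    push Not at hnd
    obtain ⟨Y, hY, hr1, hr2⟩ := hnd hXr
    by_cases hd : ∃ l, Dec L (X ∩ Y) α l
    · refine ⟨X \ Y, Set.sdiff_subset, hX.sdiff hY, ?_, by simpa using hr1⟩
      rintro ⟨l', hl'⟩
      obtain ⟨l, hl⟩ := hd
      exact hP ⟨_, hl.union hl' (by simp)⟩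
    · exact ⟨X ∩ Y, inter_subset_left, hX.inter hY, hd, by simpa using hr2⟩) X hX hcon
  exact hr (rge_succ Y h1 h2 h3 h4)

theorem Dec.params {n : ℕ} {X : Set (Fin n → N)} {α : Ordinal.{0}} {l} (h : Dec L X α l) :
    ∃ P : Set N, P.Finite ∧ (∀ Z ∈ l, P.Definable L Z ∧ Deg1 L Z α) ∧
     ∃ W, P.Definable L W ∧ ¬ RGe L W α ∧ ∀ x ∈ X, x ∈ W ∨ ∃ Z ∈ l, x ∈ Z := by
  obtain ⟨h1, W, hW, hWr, h2⟩ := h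
  obtain ⟨P, -, hP⟩ := definable_iff_finitely_definable.1 hW
  have : ∃ Q : Set N, Q.Finite ∧ ∀ Z ∈ l, Q.Definable L Z := by
    clear h2
    induction l with
    | nil => exact ⟨∅, finite_empty, by simp⟩
    | cons Z l ih =>
      obtain ⟨Q, hQ, hQ'⟩ := ih fun Z hZ => h1 Z (List.mem_cons_of_mem _ hZ)
      obtain ⟨R, -, hR⟩ := definable_iff_finitely_definable.1 (h1 Z (by simp)).1
      refine ⟨Q ∪ R, hQ.union R.finite_toSet, fun Y hY => ?_⟩
      rcases List.mem_cons.1 hY with rfl | hY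
      · exact hR.mono subset_union_right
      · exact (hQ' Y hY).mono subset_union_left
  obtain ⟨Q, hQ, hQ'⟩ := this
  exact ⟨P ∪ Q, P.finite_toSet.union hQ, fun Z hZ => ⟨(hQ' Z hZ).mono subset_union_right, (h1 Z hZ).2⟩,
    W, hP.mono subset_union_left, hWr, h2⟩

/-- generic points lie in a degree one set defined over few parameters -/
theorem deg_ex (tt : TTr L N) (A : Set N) {n : ℕ} (a : Fin n → N) :
    ∃ (α : Ordinal.{0}) (X : Set (Fin n → N)) (P : Set N), A.Definable L X ∧ a ∈ X ∧ Gn L A a α ∧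
      ¬ RGe L X (α + 1) ∧ P.Finite ∧ ∀ D, P ⊆ D → ∀ a' ∈ X, Gn L D a' α →
        ∃ Z, P.Definable L Z ∧ Deg1 L Z α ∧ a' ∈ Z := by
  obtain ⟨α, X, hX, haX, hg, hr⟩ := rank_ex tt A a
  obtain ⟨l, hl⟩ := dec_ex (hX.mono (subset_univ _)) hr
  obtain ⟨P, hP, h1, W, hW, hWr, h2⟩ := hl.params
  refine ⟨α, X, P, hX, haX, hg, hr, hP, fun D hD a' ha' hg' => ?_⟩
  rcases h2 a' ha' with h | ⟨Z, hZ, h⟩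
  · exact absurd (hg' W (hW.mono hD) h) hWr
  · exact ⟨Z, (h1 Z hZ).1, (h1 Z hZ).2, h⟩
end Mon
end Paper

namespace Paper
variable {L : FirstOrder.Language.{u, v}}

section Sym
variable {N : Type w} [L.Structure N] {A B : Set N}

theorem def_fib {κ κ' : Type*} (A : Set N) (b : κ' → N) (X : Set (κ → N)) :
    (A ∪ range b).Definable L X ↔ ∃ R : Set (κ ⊕ κ' → N), A.Definable L R ∧ X = {x | Sum.elim x b ∈ R} := by
  have h0 : A ∪ range b = range (Sum.elim (fun x : A => (x : N)) b) := by
    rw [Sum.elim_range, Subtype.range_coe]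
  rw [h0, def_range]
  let g : (A ⊕ κ') ⊕ κ → A ⊕ (κ ⊕ κ') :=
    Sum.elim (Sum.elim Sum.inl (fun i => Sum.inr (Sum.inr i))) (fun i => Sum.inr (Sum.inl i))
  let g' : A ⊕ (κ ⊕ κ') → (A ⊕ κ') ⊕ κ :=
    Sum.elim (fun i => Sum.inl (Sum.inl i)) (Sum.elim Sum.inr (fun i => Sum.inl (Sum.inr i)))
  constructor
  · rintro ⟨φ, rfl⟩
    refine ⟨_, (def_set A _).2 ⟨φ.relabel g, rfl⟩, ?_⟩
    ext x
    simp only [mem_ofPred_eq, Formula.realize_relabel]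
    have : Sum.elim (fun a : A => (a : N)) (Sum.elim x b) ∘ g = Sum.elim (Sum.elim (fun a : A => (a : N)) b) x := by
      funext i; rcases i with (i | i) | i <;> rfl
    rw [this]
  · rintro ⟨R, hR, rfl⟩
    obtain ⟨φ, rfl⟩ := (def_set A R).1 hR
    refine ⟨φ.relabel g', ?_⟩
    ext x
    simp only [mem_ofPred_eq, Formula.realize_relabel]
    have : Sum.elim (Sum.elim (fun a : A => (a : N)) b) x ∘ g' = Sum.elim (fun a : A => (a : N)) (Sum.elim x b) := by
      funext i; rcases i with i | i | i <;> rfl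
    rw [this]

theorem rat_chain (m : Mon L N) {n p : ℕ} (R : Set (Fin n ⊕ Fin p → N)) (hR : (univ : Set N).Definable L R)
    (x : ℕ → Fin n → N) (y : ℕ → Fin p → N) (h : ∀ i j, Sum.elim (x i) (y j) ∈ R ↔ i < j) :
    ∃ (x' : ℚ → Fin n → N) (y' : ℚ → Fin p → N), ∀ i j, Sum.elim (x' i) (y' j) ∈ R ↔ i < j := by
  classical
  have : Nonempty N := by
    rw [← mk_ne_zero_iff]
    exact (aleph0_pos.trans_le m.inf).ne'
  obtain ⟨P, -, hP⟩ := definable_iff_finitely_definable.1 hR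
  obtain ⟨φ, rfl⟩ := (def_set _ R).1 hP
  let U : Ultrafilter (Finset ℚ) := Ultrafilter.of Filter.atTop
  let M := (U : Filter (Finset ℚ)).Product (fun _ => N)
  let e : Finset ℚ → ℚ → ℕ := fun S q => (S.filter (· < q)).card
  have he : ∀ S : Finset ℚ, ∀ q ∈ S, ∀ r ∈ S, (e S q < e S r ↔ q < r) := by
    intro S
    have key : ∀ q ∈ S, ∀ r, q < r → e S q < e S r := by
      intro q hq r hqr
      apply Finset.card_lt_card
      rw [Finset.ssubset_iff_of_subset]
      · exact ⟨q, by simp [hq, hqr], by simp⟩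
      · intro z hz
        simp only [Finset.mem_filter] at hz ⊢
        exact ⟨hz.1, hz.2.trans hqr⟩
    intro q hq r hr
    refine ⟨fun h => ?_, key q hq r⟩
    by_contra hc
    rcases (not_lt.1 hc).eq_or_lt with h' | h'
    · rw [h'] at h; exact lt_irrefl _ h
    · exact lt_asymm h (key r hr q h')
  let sP : ↥(P : Set N) → M := fun d => ((fun _ => (d : N)) : Finset ℚ → N)
  let X : ℚ → Fin n → M := fun q i => ((fun S => x (e S q) i) : Finset ℚ → N)
  let Y : ℚ → Fin p → M := fun q i => ((fun S => y (e S q) i) : Finset ℚ → N)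
  have hTE : TE L sP (fun d : (P : Set N) => (d : N)) := by
    intro ψ
    have := Ultraproduct.realize_formula_cast (u := U) (M := fun _ => N) ψ (fun d _ => (d : N))
    refine this.trans ?_
    exact Filter.eventually_const
  have hXY : ∀ q r, φ.Realize (Sum.elim sP (Sum.elim (X q) (Y r))) ↔ q < r := by
    intro q r
    have := Ultraproduct.realize_formula_cast (u := U) (M := fun _ => N) φ
      (Sum.elim (fun d _ => (d : N)) (Sum.elim (fun i S => x (e S q) i) (fun i S => y (e S r) i)))
    have e1 : (fun i => ((Sum.elim (fun (d : (P : Set N)) (_ : Finset ℚ) => (d : N)) (Sum.elim (fun i S => x (e S q) i) (fun i S => y (e S r) i)) i : Finset ℚ → N) : M))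
      = Sum.elim sP (Sum.elim (X q) (Y r)) := by
      funext i; rcases i with i | i | i <;> rfl
    rw [← e1]
    refine this.trans ?_
    have e2 : ∀ S : Finset ℚ, (fun i => Sum.elim (fun (d : (P : Set N)) (_ : Finset ℚ) => (d : N)) (Sum.elim (fun i S => x (e S q) i) (fun i S => y (e S r) i)) i S) = Sum.elim (fun d : (P : Set N) => (d : N)) (Sum.elim (x (e S q)) (y (e S r))) := by
      intro a; funext i; rcases i with i | i | i <;> rfl
    simp only [e2]
    have hev : ∀ᶠ S in (U : Filter (Finset ℚ)), (φ.Realize (Sum.elim (fun d : (P : Set N) => (d : N)) (Sum.elim (x (e S q)) (y (e S r)))) ↔ q < r) := by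
      have h1 : ∀ᶠ S in (Filter.atTop : Filter (Finset ℚ)), {q, r} ⊆ S := Filter.eventually_ge_atTop _
      have h2 : ∀ᶠ S in (U : Filter (Finset ℚ)), {q, r} ⊆ S := Ultrafilter.of_le _ h1
      filter_upwards [h2] with S hS
      rw [← he S q (hS (by simp)) r (hS (by simp))]
      exact h _ _
    rw [Filter.eventually_congr hev]
    exact Filter.eventually_const
  obtain ⟨c, hc⟩ := ext_many m.inf m.sat hTE (by
      rw [Subtype.range_coe]; exact m.fin P.finite_toSet) (ι' := ULift.{w} (ℚ × (Fin n ⊕ Fin p)))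
      (by
        rw [mk_uLift]
        have : #(ℚ × (Fin n ⊕ Fin p)) ≤ ℵ₀ := mk_le_aleph0
        calc lift.{w} #(ℚ × (Fin n ⊕ Fin p)) ≤ ℵ₀ := lift_le_aleph0.2 this
          _ < _ := aleph0_lt_aleph_one.trans m.big)
      (fun i => Sum.elim (X i.down.1) (Y i.down.1) i.down.2)
  refine ⟨fun q i => c ⟨(q, Sum.inl i)⟩, fun q i => c ⟨(q, Sum.inr i)⟩, fun q r => ?_⟩
  rw [← hXY q r]
  have := (TE.comp hc (Sum.map id (Sum.elim (fun i => ⟨(q, Sum.inl i)⟩) (fun i => ⟨(r, Sum.inr i)⟩)))) φ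
  refine Iff.trans ?_ (this.symm.trans ?_)
  · refine iff_of_eq ?_
    show φ.Realize _ = φ.Realize _
    congr 1
    funext i; rcases i with i | i | i <;> rfl
  · refine iff_of_eq ?_
    congr 1
    funext i; rcases i with i | i | i <;> rfl

theorem nop (m : Mon L N) (tt : TTr L N) {n p : ℕ} (R : Set (Fin n ⊕ Fin p → N)) (hR : (univ : Set N).Definable L R)
    (x : ℕ → Fin n → N) (y : ℕ → Fin p → N) (h : ∀ i j, Sum.elim (x i) (y j) ∈ R ↔ i < j) : False := by
  obtain ⟨x, y, hxy⟩ := rat_chain m R hR x y h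
  let Rich : Set (Fin n → N) → Prop := fun X => ∃ (x : ℚ → Fin n → N) (y : ℚ → Fin p → N),
    (∀ i, x i ∈ X) ∧ ∀ i j, Sum.elim (x i) (y j) ∈ R ↔ i < j
  have hne : {γ | ∃ X, (univ : Set N).Definable L X ∧ Rich X ∧ ¬ RGe L X γ}.Nonempty := by
    obtain ⟨γ, hγ⟩ := tt n univ definable_univ
    exact ⟨γ, univ, definable_univ, ⟨x, y, fun _ => mem_univ _, hxy⟩, hγ⟩
  obtain ⟨X, hX, hXr, hXγ⟩ := csInf_mem hne
  have hlt : ∀ β < sInf {γ | ∃ X, (univ : Set N).Definable L X ∧ Rich X ∧ ¬ RGe L X γ},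
      ∀ X, (univ : Set N).Definable L X → Rich X → RGe L X β := by
    intro β hβ Y hY hYr
    by_contra hc
    exact notMem_of_lt_csInf' hβ ⟨Y, hY, hYr, hc⟩
  apply hXγ
  rw [RGe]
  refine ⟨hXr.elim fun x h => h.elim fun y h => ⟨x 0, h.1 0⟩, fun β hβ => ?_⟩
  refine split_seq Rich β ?_ X hX hXr
  rintro Y hY ⟨x, y, hxY, hxy⟩
  have hF : (univ : Set N).Definable L {z | Sum.elim z (y 0) ∈ R} := by
    have := (def_fib (L := L) univ (y 0) {z : Fin n → N | Sum.elim z (y 0) ∈ R}).2 ⟨R, hR, rfl⟩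
    exact this.mono (subset_univ _)
  refine ⟨Y ∩ {z | Sum.elim z (y 0) ∈ R}, inter_subset_left, hY.inter hF, ?_, ?_⟩
  · obtain ⟨f⟩ := Order.embedding_from_countable_to_dense ℚ (Set.Iio (0 : ℚ))
    refine ⟨fun q => x (f q), fun q => y (f q), fun q => ⟨hxY _, (hxy _ _).2 (f q).2⟩, fun i j => ?_⟩
    rw [hxy]; exact f.lt_iff_lt
  · refine hlt β hβ _ (hY.sdiff (hY.inter hF)) ?_
    obtain ⟨f⟩ := Order.embedding_from_countable_to_dense ℚ (Set.Ioi (0 : ℚ))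
    refine ⟨fun q => x (f q), fun q => y (f q), fun q => ⟨hxY _, fun h => ?_⟩, fun i j => ?_⟩
    · exact lt_asymm ((hxy _ _).1 h.2) (f q).2
    rw [hxy]; exact f.lt_iff_lt

theorem sym (m : Mon L N) (tt : TTr L N) (hA : #A < #N) {n p : ℕ} {a : Fin n → N} {b : Fin p → N}
    (hab : Ind L A a (A ∪ range b)) : Ind L A b (A ∪ range a) := by
  obtain ⟨α, X, P, hX, haX, hga, hra, hP, hdeg⟩ := deg_ex tt A a
  obtain ⟨β, Y, hY, hbY, hgb, hrb⟩ := rank_ex tt A b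
  have hD : #(A ∪ P : Set N) < #N := m.union hA (m.fin hP)
  obtain ⟨b', hb', hib'⟩ := m.nfe tt (A := A) (D := A ∪ P) subset_union_left hD b
  obtain ⟨a0, ha0⟩ := m.ext hA hb' a
  obtain ⟨a', ha', hia'⟩ := m.nfe tt (A := A ∪ range b') (D := (A ∪ P) ∪ range b')
    (union_subset_union_left _ subset_union_left) (m.union hD (m.rng _)) a0
  have hT : TA L A (Sum.elim b a) (Sum.elim b' a') := ha0.trans ha'.unshift
  have ga' : Gn L ((A ∪ P) ∪ range b') a' α := hia' α (m.gn hA hT (hab α hga))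
  have gb' : Gn L (A ∪ P) b' β := hib' β (m.gn0 hb' hgb)
  have haX' : a' ∈ X := (hT.right.mem hX).1 haX
  obtain ⟨Z, hZ, hZ1, haZ⟩ := hdeg _ subset_union_right a' haX' (ga'.anti_set subset_union_left)
  suffices hs : Gn L ((A ∪ P) ∪ range a') b' β by
    intro γ hγ
    refine gn_all hY hbY hrb ?_ hγ
    exact m.gn hA hT.symm.swap (hs.anti_set (union_subset_union_left _ subset_union_left))
  by_contra hcon
  unfold Gn at hcon
  push Not at hcon
  obtain ⟨V, hV, hbV, hrV⟩ := hcon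
  obtain ⟨R, hR, rfl⟩ := (def_fib _ _ _).1 hV
  set D := A ∪ P with hDdef
  have hfib : ∀ a1, TA L D a' a1 → ¬ RGe L {y | Sum.elim y a1 ∈ R} β := by
    intro a1 h1 hc
    apply hrV
    obtain ⟨φ, rfl⟩ := (def_set _ R).1 hR
    have := rge_inv m.sat m.big β h1.symm (by
      rw [Sum.elim_range, Subtype.range_coe]
      exact m.union hD (m.rng _)) (φ.relabel (Sum.elim (fun d => Sum.inl (Sum.inl d)) (Sum.elim Sum.inr (fun i => Sum.inl (Sum.inr i)))))
    simp only [Formula.realize_relabel] at this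
    have e : ∀ (a : Fin n → N) (y : Fin p → N), Sum.elim (Sum.elim (fun x : D => (x : N)) a) y ∘ (Sum.elim (fun d => Sum.inl (Sum.inl d)) (Sum.elim Sum.inr (fun i => Sum.inl (Sum.inr i)))) = Sum.elim (fun x : D => (x : N)) (Sum.elim y a) := by
      intro a y
      funext i; rcases i with i | i | i <;> rfl
    simp only [e] at this
    exact this hc
  have huniq : ∀ b1 a1, TA L D b' b1 → a1 ∈ Z → Gn L (D ∪ range b1) a1 α → Sum.elim b1 a1 ∈ R := by
    intro b1 a1 hb1 ha1 hg1
    obtain ⟨a2, ha2⟩ := m.ext hD hb1 a'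
    have h2 : TA L (D ∪ range b1) a2 a1 := hZ1.uniq (hZ.mono (subset_union_right.trans subset_union_left))
      ((ha2.right.mem (hZ.mono subset_union_right)).1 haZ) ha1 (m.gn hD ha2 ga') hg1
    have h3 : TA L D (Sum.elim b' a') (Sum.elim b1 a1) := ha2.trans h2.unshift
    exact (h3.mem hR).1 hbV
  obtain ⟨f, hf1, hf2⟩ := exists_seq_of_forall_finset_exists
    (fun q : (Fin n → N) × (Fin p → N) => TA L D a' q.1 ∧ TA L D b' q.2 ∧ Sum.elim q.2 q.1 ∉ R)
    (fun q q1 => Sum.elim q.2 q1.1 ∈ R ∧ Sum.elim q1.2 q.1 ∉ R) (by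
    intro S hS
    let Eb : Set N := ⋃ q ∈ S, range q.2
    let Ea : Set N := ⋃ q ∈ S, range q.1
    have hEb : Eb.Finite := S.finite_toSet.biUnion fun q _ => finite_range _
    have hEa : Ea.Finite := S.finite_toSet.biUnion fun q _ => finite_range _
    obtain ⟨a1, h1, h1'⟩ := m.nfe tt (A := D) (D := D ∪ Eb) subset_union_left (m.union hD (m.fin hEb)) a'
    obtain ⟨b1, h2, h2'⟩ := m.nfe tt (A := D) (D := D ∪ (Ea ∪ range a1)) subset_union_left
      (m.union hD (m.union (m.fin hEa) (m.rng _))) b'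
    have hga1 : Gn L (D ∪ Eb) a1 α := h1' α (m.gn0 h1 (ga'.anti_set subset_union_left))
    have hgb1 : Gn L (D ∪ (Ea ∪ range a1)) b1 β := h2' β (m.gn0 h2 gb')
    have hno : ∀ a2, TA L D a' a2 → range a2 ⊆ Ea ∪ range a1 → Sum.elim b1 a2 ∉ R := by
      intro a2 ha2 hr hc
      apply hfib a2 ha2
      exact hgb1 _ (((def_fib D a2 _).2 ⟨R, hR, rfl⟩).mono (union_subset_union_right _ hr)) hc
    refine ⟨(a1, b1), ⟨h1, h2, hno a1 h1 subset_union_right⟩, fun q hq => ⟨?_, ?_⟩⟩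
    · refine huniq q.2 a1 (hS q hq).2.1 ((h1.mem (hZ.mono subset_union_right)).1 haZ) (hga1.anti_set ?_)
      exact union_subset_union_right _ (subset_biUnion_of_mem (u := fun q => range q.2) hq)
    · exact hno q.1 (hS q hq).1 ((subset_biUnion_of_mem (u := fun q => range q.1) hq).trans subset_union_left))
  refine nop m tt R (hR.mono (subset_univ _)) (fun i => (f i).2) (fun i => (f i).1) fun i j => ?_
  rcases lt_trichotomy i j with h | rfl | h
  · exact iff_of_true (hf2 _ _ h).1 h
  · exact iff_of_false (hf1 _).2.2 (lt_irrefl _)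
  · exact iff_of_false (hf2 _ _ h).2 h.not_gt

theorem gn_fin {D : Set N} {n : ℕ} {b : Fin n → N} {α : Ordinal.{0}} {E : Set N}
    (h : ∀ (k : ℕ) (c : Fin k → N), range c ⊆ E → Gn L (D ∪ range c) b α) : Gn L (D ∪ E) b α := by
  classical
  intro X hX hb
  obtain ⟨P, hP, hP'⟩ := definable_iff_finitely_definable.1 hX
  let Q := P.filter (· ∈ E)
  obtain ⟨k, c, hc⟩ : ∃ k, ∃ c : Fin k → N, range c = (Q : Set N) := by
    refine ⟨_, fun i => (Q.equivFin.symm i : N), ?_⟩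
    ext x
    simp only [mem_range, Finset.mem_coe]
    constructor
    · rintro ⟨i, rfl⟩; exact (Q.equivFin.symm i).2
    · intro hx; exact ⟨Q.equivFin ⟨x, hx⟩, by simp⟩
  refine h k c (by rw [hc]; intro x hx; exact (Finset.mem_filter.1 hx).2) X (hP'.mono ?_) hb
  intro x hx
  rcases hP hx with h | h
  · exact Or.inl h
  · refine Or.inr ?_
    rw [hc]
    exact Finset.mem_coe.2 (Finset.mem_filter.2 ⟨hx, h⟩)

theorem lemP (m : Mon L N) (tt : TTr L N) (hA : #A < #N) {n p : ℕ} {g : Fin n → N} {b : Fin p → N}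
    {E : Set N} (hg : Ind L A g (A ∪ E)) (hb : Ind L (A ∪ range g) b ((A ∪ range g) ∪ E)) :
    Ind L A b (A ∪ E) := by
  intro α hα
  apply gn_fin
  intro k c hc
  have h1 : Ind L A c (A ∪ range g) := sym m tt hA fun γ hγ =>
    (hg γ hγ).anti_set (union_subset_union_right _ hc)
  have h2 : Ind L (A ∪ range g) c ((A ∪ range g) ∪ range b) := sym m tt (m.union hA (m.rng _)) fun γ hγ =>
    (hb γ hγ).anti_set (union_subset_union_right _ hc)
  have h3 : Ind L A c (A ∪ range b) := fun γ hγ =>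
    (h2 γ (h1 γ hγ)).anti_set (union_subset_union_left _ subset_union_left)
  exact sym m tt hA h3 α hα
end Sym
end Paper

namespace Paper
variable {L : FirstOrder.Language.{u, v}}

section Red
variable {N : Type w} [L.Structure N] {A B : Set N}

theorem indep_ind {n : ℕ} {a : Fin n → N} : Indep (L := L) A a B ↔ Ind L A a (A ∪ B) := indep_iff A a B

/-- data of a finite reduction of a stationary type -/
structure Red (L : FirstOrder.Language.{u, v}) {N : Type w} [L.Structure N] (B : Set N) {n : ℕ}
    (b : Fin n → N) (P : Set N) (X : Set (Fin n → N)) (α : Ordinal.{0}) : Prop where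
  sub : P ⊆ B
  fin : P.Finite
  df : P.Definable L X
  mem : b ∈ X
  deg : Deg1 L X α
  gn : Gn L B b α
  pos : 1 ≤ α

theorem Dec.drop {n : ℕ} {X U V Z : Set (Fin n → N)} {α : Ordinal.{0}} {l} (h : Dec L X α (Z :: l))
    (hU : U ⊆ X) (hV : (univ : Set N).Definable L V) (hVr : ¬ RGe L V α)
    (h' : ∀ x ∈ U, x ∈ Z → x ∈ V ∨ ∃ Z' ∈ l, x ∈ Z') : Dec L U α l := by
  obtain ⟨h1, W, hW, hWr, h2⟩ := h
  refine ⟨fun Z' hZ' => h1 Z' (List.mem_cons_of_mem _ hZ'), W ∪ V, hW.union hV,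
    fun hr => (RGe.union α hW hV hr).elim hWr hVr, fun x hx => ?_⟩
  rcases h2 x (hU hx) with h | ⟨Z', hZ', h⟩
  · exact Or.inl (Or.inl h)
  · rcases List.mem_cons.1 hZ' with rfl | hZ'
    · rcases h' x hx h with h | h
      · exact Or.inl (Or.inr h)
      · exact Or.inr h
    · exact Or.inr ⟨Z', hZ', h⟩

theorem Dec.perm {n : ℕ} {X : Set (Fin n → N)} {α : Ordinal.{0}} {l l'} (h : Dec L X α l)
    (hl : ∀ Z, Z ∈ l ↔ Z ∈ l') : Dec L X α l' := by
  obtain ⟨h1, W, hW, hWr, h2⟩ := h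
  refine ⟨fun Z hZ => h1 Z ((hl Z).2 hZ), W, hW, hWr, fun x hx => ?_⟩
  rcases h2 x hx with h | ⟨Z, hZ, h⟩
  · exact Or.inl h
  · exact Or.inr ⟨Z, (hl Z).1 hZ, h⟩

theorem inAcl_of_finite {n : ℕ} {b : Fin n → N} {X : Set (Fin n → N)} (hX : B.Definable L X)
    (hb : b ∈ X) (hf : X.Finite) (i : Fin n) : InAcl (L := L) B (b i) := by
  have h1 := hX.image_comp (fun _ : Fin 1 => i)
  obtain ⟨φ, hφ⟩ := (def_set _ _).1 h1
  refine ⟨φ, ?_, ?_⟩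
  · have : (b ∘ fun _ : Fin 1 => i) ∈ (fun g : Fin n → N => g ∘ fun _ : Fin 1 => i) '' X := ⟨b, hb, rfl⟩
    rw [hφ] at this
    exact this
  · have h2 : ((fun g : Fin n → N => g ∘ fun _ : Fin 1 => i) '' X).Finite := hf.image _
    rw [hφ] at h2
    exact h2.preimage (f := fun (x : N) (_ : Fin 1) => x) (fun x _ y _ hxy => congrFun hxy 0)

theorem finred (m : Mon L N) (tt : TTr L N) (hB : #B < #N) {n : ℕ} {b : Fin n → N}
    (hreg : Regular (L := L) #N B b) : ∃ P X α, Red L B b P X α := by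
  classical
  obtain ⟨hst, ⟨i, hi⟩, -⟩ := hreg
  obtain ⟨α, X0, hX0, hbX0, hgn, hr0⟩ := rank_ex tt B b
  have hpos : 1 ≤ α := by
    by_contra hc
    rw [not_le, Order.lt_one_iff] at hc
    subst hc
    apply hi
    refine inAcl_of_finite hX0 hbX0 ?_ i
    by_contra hinf
    rw [zero_add] at hr0
    exact hr0 (rge_one_of_infinite hinf)
  have hex : ∃ r, ∃ X, B.Definable L X ∧ b ∈ X ∧ ∃ l, Dec L X α l ∧ l.length = r := by
    obtain ⟨l, hl⟩ := dec_ex (hX0.mono (subset_univ _)) hr0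
    exact ⟨_, X0, hX0, hbX0, l, hl, rfl⟩
  obtain ⟨X, hX, hbX, l, hl, hlen⟩ := Nat.find_spec hex
  have hmin : ∀ Y l', B.Definable L Y → b ∈ Y → Dec L Y α l' → l.length ≤ l'.length := by
    intro Y l' hY hb hd
    rw [hlen]
    exact Nat.find_min' hex ⟨Y, hY, hb, l', hd, rfl⟩
  have hgen : ∀ Z l', Dec L X α (Z :: l') → l.length = l'.length + 1 → ∀ Y, B.Definable L Y → b ∈ Y →
      RGe L (Y ∩ Z) α := by
    intro Z l' hd hll Y hY hb
    by_contra hc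
    have hd' : Dec L (X ∩ Y) α l' := hd.drop inter_subset_left
      ((hY.mono (subset_univ _)).inter (hd.1 Z (by simp)).1) hc (fun x hx hz => Or.inl ⟨hx.2, hz⟩)
    have := hmin _ _ (hX.inter hY) ⟨hbX, hb⟩ hd'
    omega
  have hXr : RGe L X α := hgn X hX hbX
  match l, hl with
  | [], hl =>
    obtain ⟨-, W, hW, hWr, h⟩ := hl
    exact absurd (hXr.mono fun x hx => (h x hx).elim id (by simp)) hWr
  | [Z], hl =>
    obtain ⟨h1, W, hW, hWr, h⟩ := hl
    obtain ⟨hZ, hZ1⟩ := h1 Z (by simp)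
    have hdeg : Deg1 L X α := by
      refine ⟨hXr, fun Y hY hc => ?_⟩
      apply hZ1.2 Y hY
      constructor
      · refine (RGe.union α hW (hZ.inter hY) (hc.1.mono fun x hx => ?_)).resolve_left hWr
        rcases h x hx.1 with hh | ⟨Z', hZ', hh⟩
        · exact Or.inl hh
        · rw [List.mem_singleton] at hZ'; subst hZ'; exact Or.inr ⟨hh, hx.2⟩
      · refine (RGe.union α hW (hZ.sdiff hY) (hc.2.mono fun x hx => ?_)).resolve_left hWr
        rcases h x hx.1 with hh | ⟨Z', hZ', hh⟩
        · exact Or.inl hh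
        · rw [List.mem_singleton] at hZ'; subst hZ'; exact Or.inr ⟨hh, hx.2⟩
    obtain ⟨P, hP, hPX⟩ := definable_iff_finitely_definable.1 hX
    exact ⟨P, X, α, hP, P.finite_toSet, hPX, hbX, hdeg, hgn, hpos⟩
  | Z1 :: Z2 :: l', hl =>
    exfalso
    have hl2 : Dec L X α (Z2 :: Z1 :: l') := hl.perm fun Z => by
      simp only [List.mem_cons]; tauto
    have g1 := hgen Z1 _ hl (by simp)
    have g2 := hgen Z2 _ hl2 (by simp)
    obtain ⟨P1, -, hP1⟩ := definable_iff_finitely_definable.1 (hl.1 Z1 (by simp)).1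
    obtain ⟨P2, -, hP2⟩ := definable_iff_finitely_definable.1 (hl.1 Z2 (by simp)).1
    let C : Set N := B ∪ (P1 ∪ P2)
    have hC : #C < #N := m.union hB (m.union (m.fin P1.finite_toSet) (m.fin P2.finite_toSet))
    have hC1 : C.Definable L Z1 := hP1.mono (subset_union_left.trans subset_union_right)
    have hC2 : C.Definable L Z2 := hP2.mono (subset_union_right.trans subset_union_right)
    have get : ∀ Z, C.Definable L Z → (∀ Y, B.Definable L Y → b ∈ Y → RGe L (Y ∩ Z) α) →
        ∃ b', TA L B b' b ∧ b' ∈ Z ∧ Ind L B b' (B ∪ C) ∧ Gn L C b' α := by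
      intro Z hZ hZr
      obtain ⟨b', h1, h2⟩ := gen m.sat m.big C hC α {V | ∃ Y, B.Definable L Y ∧ b ∈ Y ∧ V = Y ∩ Z}
        ⟨_, X, hX, hbX, rfl⟩ (by
          rintro _ ⟨Y, hY, hb, rfl⟩ _ ⟨Y', hY', hb', rfl⟩
          exact ⟨Y ∩ Y', hY.inter hY', ⟨hb, hb'⟩, by ext; simp; tauto⟩) (by
          rintro _ ⟨Y, hY, hb, rfl⟩
          exact hZr Y hY hb) (by
          rintro _ ⟨Y, hY, hb, rfl⟩
          exact (hY.mono subset_union_left).inter hZ)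
      have h3 : ∀ Y, B.Definable L Y → b ∈ Y → b' ∈ Y ∧ b' ∈ Z := fun Y hY hb => h1 _ ⟨Y, hY, hb, rfl⟩
      refine ⟨b', (TA.of_mem fun Y hY hb => (h3 Y hY hb).1).symm, (h3 X hX hbX).2, fun β hβ => ?_, h2⟩
      refine (gn_all hX0 (h3 X0 hX0 hbX0).1 hr0 h2 hβ).anti_set ?_
      exact union_subset subset_union_left subset_rfl
    obtain ⟨b1, t1, m1, i1, n1⟩ := get Z1 hC1 g1
    obtain ⟨b2, t2, m2, i2, n2⟩ := get Z2 hC2 g2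
    have hT : TA L C b1 b2 := hst C subset_union_left hC b1 b2 t1 t2 (indep_ind.2 i1) (indep_ind.2 i2)
    have hb12 : b1 ∈ Z2 := (hT.mem hC2).2 m2
    have hr12 : RGe L (Z2 ∩ Z1) α := n1 _ (hC2.inter hC1) ⟨hb12, m1⟩
    have hZ1 := hl.1 Z1 (by simp)
    have hZ2 := hl.1 Z2 (by simp)
    have hno : ¬ RGe L (Z2 \ Z1) α := fun hc => hZ2.2.2 Z1 hZ1.1 ⟨hr12, hc⟩
    have hd : Dec L X α (Z1 :: l') := hl2.drop subset_rfl (hZ2.1.sdiff hZ1.1) hno (fun x hx hz => by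
      by_cases h : x ∈ Z1
      · exact Or.inr ⟨Z1, by simp, h⟩
      · exact Or.inl ⟨hz, h⟩)
    have := hmin _ _ hX hbX hd
    simp at this

theorem orth (m : Mon L N) (tt : TTr L N) {n p : ℕ} {Bi Bj Pi Pj : Set N} {bi : Fin n → N}
    {bj : Fin p → N} {Xi Xj αi αj} (hBi : #Bi < #N) (hBj : #Bj < #N) (hi : Red L Bi bi Pi Xi αi)
    (hj : Red L Bj bj Pj Xj αj) (hno : ¬ Nonorthogonal (L := L) #N Bj bj Bi bi) {C : Set N}
    (hC : #C < #N) (hCi : Pi ⊆ C) (hCj : Pj ⊆ C) {xi : Fin n → N} {xj : Fin p → N} (hxi : xi ∈ Xi)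
    (hxj : xj ∈ Xj) (gi : Gn L C xi αi) (gj : Gn L C xj αj) : Gn L (C ∪ range xi) xj αj := by
  let C' : Set N := C ∪ (Bi ∪ Bj)
  have hC' : #C' < #N := m.union hC (m.union hBi hBj)
  obtain ⟨xi', ti, ii⟩ := m.nfe tt (A := C) (D := C') subset_union_left hC' xi
  obtain ⟨y, ty⟩ := m.ext hC ti xj
  obtain ⟨xj', tj, ij⟩ := m.nfe tt (A := C ∪ range xi') (D := C' ∪ range xi')
    (union_subset_union_left _ subset_union_left) (m.union hC' (m.rng _)) y
  have hT : TA L C (Sum.elim xi xj) (Sum.elim xi' xj') := ty.trans tj.unshift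
  have hCC : C ⊆ C' := subset_union_left
  have hP := lemP m tt hC (g := xi') (b := xj') (E := C') (fun γ hγ => (ii γ hγ).anti_set
    (union_subset hCC subset_rfl)) (fun γ hγ => (ij γ hγ).anti_set
    (union_subset (union_subset_union_left _ hCC) subset_union_left))
  have gi' : Gn L C' xi' αi := ii _ (m.gn0 ti gi)
  have gj' : Gn L C' xj' αj := (hP _ (m.gn0 hT.right gj)).anti_set subset_union_right
  have hBiC : Bi ⊆ C' := subset_union_left.trans subset_union_right
  have hBjC : Bj ⊆ C' := subset_union_right.trans subset_union_right
  have mi : xi' ∈ Xi := (ti.mem (hi.df.mono hCi)).1 hxi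
  have mj : xj' ∈ Xj := (hT.right.mem (hj.df.mono hCj)).1 hxj
  have hind : Indep (L := L) C' xj' (range xi') := by
    by_contra hc
    refine hno ⟨C', union_subset hBjC hBiC, hC', xj', xi', ?_, ?_, ?_, ?_, hc⟩
    · exact hj.deg.uniq (hj.df.mono hj.sub) mj hj.mem (gj'.anti_set hBjC) hj.gn
    · rw [indep_ind]
      exact fun β hβ => (gn_all (hj.df.mono hj.sub) mj hj.deg.not_succ gj' hβ).anti_set
        (union_subset hBjC subset_rfl)
    · exact hi.deg.uniq (hi.df.mono hi.sub) mi hi.mem (gi'.anti_set hBiC) hi.gn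
    · rw [indep_ind]
      exact fun β hβ => (gn_all (hi.df.mono hi.sub) mi hi.deg.not_succ gi' hβ).anti_set
        (union_subset hBiC subset_rfl)
  have := (indep_ind.1 hind _ gj').anti_set (union_subset_union_left (range xi') hCC)
  exact m.gn hC hT.symm this
end Red
end Paper

namespace Paper
variable {L : FirstOrder.Language.{u, v}}

/-- algebraic tuples -/
def AC (L : FirstOrder.Language.{u, v}) {N : Type*} [L.Structure N] (A : Set N) {κ : Type*}
    (d : κ → N) : Prop := ∃ X : Set (κ → N), A.Definable L X ∧ d ∈ X ∧ X.Finite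

section Acl
variable {N : Type w} [L.Structure N] {A B : Set N}

theorem AC.mono {κ : Type*} {d : κ → N} (h : AC L A d) (hAB : A ⊆ B) : AC L B d := by
  obtain ⟨X, h1, h2⟩ := h
  exact ⟨X, h1.mono hAB, h2⟩

theorem AC.tuple {κ : Type*} [Finite κ] {d : κ → N} (h : ∀ i, AC L A (fun _ : Fin 1 => d i)) :
    AC L A d := by
  choose X h1 h2 h3 using h
  refine ⟨⋂ i, {x | (fun _ : Fin 1 => x i) ∈ X i}, ?_, ?_, ?_⟩
  · apply definable_iInter_of_finite
    intro i
    exact (h1 i).preimage_comp (fun _ : Fin 1 => i)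
  · exact mem_iInter.2 h2
  · have := Set.Finite.pi' h3
    refine Set.Finite.of_finite_image (f := fun (x : κ → N) i (_ : Fin 1) => x i) (this.subset ?_) ?_
    · rintro _ ⟨x, hx, rfl⟩ i
      exact mem_iInter.1 hx i
    · intro x _ y _ hxy
      funext i
      exact congrFun (congrFun hxy i) 0

theorem AC.small {κ : Type*} {d : κ → N} (h : AC L A d) : ∃ P : Finset N, (P : Set N) ⊆ A ∧ AC L (P : Set N) d := by
  obtain ⟨X, h1, h2⟩ := h
  obtain ⟨P, hP, hP'⟩ := definable_iff_finitely_definable.1 h1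
  exact ⟨P, hP, X, hP', h2⟩

theorem coords_mono {k : ℕ} {I J : Set (Fin k → N)} (h : I ⊆ J) : coords I ⊆ coords J :=
  biUnion_subset_biUnion_left h

theorem coords_ctbl {k : ℕ} {I : Set (Fin k → N)} (h : I.Countable) : (coords I).Countable :=
  h.biUnion fun _ _ => (finite_range _).countable

theorem coords_range {k : ℕ} (J : Set (Fin k → N)) :
    coords J = range (fun p : J × Fin k => p.1.1 p.2) := by
  ext x
  simp only [coords, mem_iUnion, mem_range, Prod.exists, Subtype.exists, exists_prop]

theorem fin_enum (P : Finset N) : ∃ k, ∃ c : Fin k → N, range c = (P : Set N) := by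
  refine ⟨_, fun i => (P.equivFin.symm i : N), ?_⟩
  ext x
  simp only [mem_range, Finset.mem_coe]
  constructor
  · rintro ⟨i, rfl⟩; exact (P.equivFin.symm i).2
  · intro hx; exact ⟨P.equivFin ⟨x, hx⟩, by simp⟩

theorem coords_fin {k : ℕ} {I : Set (Fin k → N)} (P : Finset N) (hP : (P : Set N) ⊆ coords I) :
    ∃ F ⊆ I, F.Finite ∧ (P : Set N) ⊆ coords F := by
  have : ∀ x : (P : Set N), ∃ e ∈ I, (x : N) ∈ range e := by
    intro x
    have := hP x.2
    simpa only [coords, mem_iUnion, exists_prop] using this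
  choose e he hx using this
  refine ⟨range e, range_subset_iff.2 he, finite_range e, fun x hxP => ?_⟩
  exact mem_biUnion (mem_range_self ⟨x, hxP⟩) (hx ⟨x, hxP⟩)

theorem indisc {k : ℕ} {I : Set (Fin k → N)} (hI : IsIndiscSet (L := L) I) {ι : Type*}
    (g h : ι → Fin k → N) (hg : Function.Injective g) (hh : Function.Injective h)
    (hgI : ∀ i, g i ∈ I) (hhI : ∀ i, h i ∈ I) :
    TE L (fun p : ι × Fin k => g p.1 p.2) (fun p : ι × Fin k => h p.1 p.2) := by
  classical
  apply TE.of_fin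
  intro n q
  let S : Finset ι := Finset.univ.image (fun j => (q j).1)
  let e := S.equivFin
  have h1 : TE L (fun p : Fin S.card × Fin k => g (e.symm p.1) p.2)
      (fun p : Fin S.card × Fin k => h (e.symm p.1) p.2) :=
    hI S.card (fun i => g (e.symm i)) (fun i => h (e.symm i))
      (hg.comp (Subtype.val_injective.comp e.symm.injective))
      (hh.comp (Subtype.val_injective.comp e.symm.injective)) (fun i => hgI _) (fun i => hhI _)
  have h2 := h1.comp (fun j => (e ⟨(q j).1, Finset.mem_image_of_mem _ (Finset.mem_univ j)⟩, (q j).2))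
  convert h2 using 1 <;> funext j <;> simp

theorem aclind_core (m : Mon L N) {k : ℕ} {I : Set (Fin k → N)} (hI : IsIndiscSet (L := L) I)
    {J : Set (Fin k → N)} (hJ : J ⊆ I) (hJc : J.Countable) {r n : ℕ} {F : Fin r → Fin k → N}
    (hF : Function.Injective F) (hFI : ∀ i, F i ∈ I \ J) (f : ℕ × Fin r → Fin k → N)
    (hf : Function.Injective f) (hfI : ∀ i, f i ∈ I \ J) (hFf : ∀ i j, F i ≠ f j)
    {d : Fin n → N} (hd : AC L (coords J) d) {R : Set ((Fin r × Fin k) ⊕ Fin n → N)}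
    (hR : (∅ : Set N).Definable L R)
    (h1 : Sum.elim (fun p => F p.1 p.2) d ∈ R)
    (h2 : ∀ t, Sum.elim (fun p => f (t, p.1) p.2) d ∉ R) : False := by
  classical
  obtain ⟨V, hV, hdV, hVf⟩ := hd
  rw [coords_range, def_range] at hV
  obtain ⟨χ, rfl⟩ := hV
  obtain ⟨ρ, hρ⟩ := (def_set _ _).1 hR
  have hRi : ∀ {x y : (Fin r × Fin k) ⊕ Fin n → N}, TE L x y → (x ∈ R ↔ y ∈ R) := by
    intro x y hxy
    rw [hρ]
    have : TE L (Sum.elim (fun a : (∅ : Set N) => (a : N)) x) (Sum.elim (fun a : (∅ : Set N) => (a : N)) y) := by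
      apply TE.of_fin
      intro n g
      have : ∀ i, ∃ j, g i = Sum.inr j := by
        intro i
        rcases hgi : g i with j | j
        · exact absurd j.2 (notMem_empty _)
        · exact ⟨j, rfl⟩
      choose g' hg' using this
      have h1 := hxy.comp g'
      convert h1 using 1 <;> funext i <;> simp [hg']
    exact this ρ
  let blk : Option ℕ × Fin r → Fin k → N := fun p => match p.1 with
    | none => F p.2
    | some t => f (t, p.2)
  have hblk : Function.Injective blk := by
    rintro ⟨_ | t, i⟩ ⟨_ | t', i'⟩ h
    · have := hF h; subst this; rfl
    · exact absurd h (hFf _ _)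
    · exact absurd h.symm (hFf _ _)
    · have := hf h; cases this; rfl
  have hblkI : ∀ p, blk p ∈ I \ J := by
    rintro ⟨_ | t, i⟩
    · exact hFI i
    · exact hfI (t, i)
  let g : Equiv.Perm (Option ℕ) → J ⊕ (Option ℕ × Fin r) → Fin k → N := fun σ =>
    Sum.elim (fun x : J => (x : Fin k → N)) (fun p => blk (σ p.1, p.2))
  have hgi : ∀ σ, Function.Injective (g σ) := by
    intro σ
    refine Function.Injective.sumElim Subtype.val_injective ?_ ?_
    · rintro ⟨a, b⟩ ⟨a', b'⟩ h
      have := hblk h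
      simp only [Prod.mk.injEq, σ.injective.eq_iff] at this
      exact Prod.ext this.1 this.2
    · intro a b h
      exact (hblkI (σ b.1, b.2)).2 (h ▸ a.2)
  have hgI : ∀ σ i, g σ i ∈ I := by
    rintro σ (x | p)
    · exact hJ x.2
    · exact (hblkI _).1
  have hext : ∀ s : ℕ, ∃ d' : Fin n → N,
      TE L (Sum.elim (fun p : (J ⊕ (Option ℕ × Fin r)) × Fin k => g 1 p.1 p.2) d)
        (Sum.elim (fun p : (J ⊕ (Option ℕ × Fin r)) × Fin k => g (Equiv.swap none (some s)) p.1 p.2) d') := by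
    intro s
    have hJc' : Countable J := hJc
    exact ext_fin m.inf m.sat (indisc hI _ _ (hgi _) (hgi _) (hgI _) (hgI _))
      (m.ctbl (countable_range _)) d
  choose d' hd' using hext
  have hV' : ∀ s, d' s ∈ {x | χ.Realize (Sum.elim (fun p : J × Fin k => p.1.1 p.2) x)} := by
    intro s
    have := (hd' s).comp (Sum.map (fun p : J × Fin k => (Sum.inl p.1, p.2)) id)
    have h3 : TE L (Sum.elim (fun p : J × Fin k => p.1.1 p.2) d)
        (Sum.elim (fun p : J × Fin k => p.1.1 p.2) (d' s)) := by
      convert this using 1 <;> funext i <;> rcases i with i | i <;> rfl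
    exact (h3 χ).1 hdV
  have hmove : ∀ s (o : Option ℕ), TE L (Sum.elim (fun p : Fin r × Fin k => blk (o, p.1) p.2) d)
        (Sum.elim (fun p : Fin r × Fin k => blk (Equiv.swap none (some s) o, p.1) p.2) (d' s)) := by
    intro s o
    have := (hd' s).comp (Sum.map (fun p : Fin r × Fin k => (Sum.inr (o, p.1), p.2)) id)
    convert this using 1 <;> funext i <;> rcases i with i | i <;> rfl
  have hin : ∀ s, Sum.elim (fun p => f (s, p.1) p.2) (d' s) ∈ R := by
    intro s
    have := hmove s none
    rw [Equiv.swap_apply_left] at this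
    exact (hRi this).1 h1
  have hout : ∀ s t, s ≠ t → Sum.elim (fun p => f (t, p.1) p.2) (d' s) ∉ R := by
    intro s t hst hc
    have := hmove s (some t)
    rw [Equiv.swap_apply_of_ne_of_ne (by simp) (by simpa using hst.symm)] at this
    exact h2 t ((hRi this).2 hc)
  have hinj : Function.Injective d' := by
    intro s t hst
    by_contra hne
    exact hout t s (fun h => hne h.symm) (hst ▸ hin s)
  exact infinite_range_of_injective hinj (hVf.subset (range_subset_iff.2 hV'))

theorem aclind (m : Mon L N) {k : ℕ} {I : Set (Fin k → N)} (hI : IsIndiscSet (L := L) I)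
    (hIu : ¬ I.Countable) {J : Set (Fin k → N)} (hJ : J ⊆ I) (hJc : J.Countable) {r : ℕ}
    {F F' : Fin r → Fin k → N}
    (hF : Function.Injective F) (hFI : ∀ i, F i ∈ I \ J)
    (hF' : Function.Injective F') (hFI' : ∀ i, F' i ∈ I \ J) {E : Set N}
    (hE : ∀ x ∈ E, AC L (coords J) (fun _ : Fin 1 => x)) :
    TA L E (fun p : Fin r × Fin k => F p.1 p.2) (fun p : Fin r × Fin k => F' p.1 p.2) := by
  classical
  apply TA.of_mem
  intro X hX hFX
  by_contra hFX'
  obtain ⟨P, hP, hPX⟩ := definable_iff_finitely_definable.1 hX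
  obtain ⟨n, d, hd⟩ := fin_enum P
  rw [← hd, ← empty_union (range d), def_fib] at hPX
  obtain ⟨R, hR, rfl⟩ := hPX
  have hdA : AC L (coords J) d := AC.tuple fun i => hE _ (hP (by rw [← hd]; exact mem_range_self i))
  have hinf : (I \ (J ∪ range F ∪ range F')).Infinite := by
    intro hfin
    apply hIu
    have : (J ∪ range F ∪ range F').Countable :=
      (hJc.union (countable_range _)).union (countable_range _)
    refine (hfin.countable.union this).mono fun x hx => ?_
    by_cases h : x ∈ J ∪ range F ∪ range F'
    · exact Or.inr h
    · exact Or.inl ⟨hx, h⟩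
  obtain ⟨c⟩ : Nonempty (ℕ × Fin r ↪ ℕ) := ⟨Encodable.encode' _⟩
  let f0 : ℕ × Fin r → Fin k → N := fun p => (hinf.natEmbedding _ (c p)).1
  have hf0 : Function.Injective f0 :=
    Subtype.val_injective.comp ((hinf.natEmbedding _).injective.comp c.injective)
  have hf0I : ∀ p, f0 p ∈ I \ (J ∪ range F ∪ range F') := fun p => (hinf.natEmbedding _ (c p)).2
  have hcase : {t | Sum.elim (fun p : Fin r × Fin k => f0 (t, p.1) p.2) d ∈ R}.Infinite ∨
      {t | Sum.elim (fun p : Fin r × Fin k => f0 (t, p.1) p.2) d ∉ R}.Infinite := by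
    rw [← Set.infinite_union]
    have : {t | Sum.elim (fun p : Fin r × Fin k => f0 (t, p.1) p.2) d ∈ R} ∪
      {t | Sum.elim (fun p : Fin r × Fin k => f0 (t, p.1) p.2) d ∉ R} = (Set.univ : Set ℕ) :=
      eq_univ_of_forall fun t => Classical.em _
    rw [this]
    exact infinite_univ
  rcases hcase with hc | hc
  · let q := hc.natEmbedding
    refine aclind_core m hI hJ hJc hF' hFI' (fun p => f0 (q p.1, p.2)) ?_ ?_ ?_ hdA hR.compl hFX'
      (fun t => not_not.2 (q t).2)
    · rintro ⟨a, b⟩ ⟨a', b'⟩ h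
      have := hf0 h
      simp only [Prod.mk.injEq] at this
      exact Prod.ext (q.injective (Subtype.ext this.1)) this.2
    · exact fun p => ⟨(hf0I _).1, fun h => (hf0I _).2 (Or.inl (Or.inl h))⟩
    · exact fun i p h => (hf0I _).2 (Or.inr ⟨i, h⟩)
  · let q := hc.natEmbedding
    refine aclind_core m hI hJ hJc hF hFI (fun p => f0 (q p.1, p.2)) ?_ ?_ ?_ hdA hR hFX
      (fun t => (q t).2)
    · rintro ⟨a, b⟩ ⟨a', b'⟩ h
      have := hf0 h
      simp only [Prod.mk.injEq] at this
      exact Prod.ext (q.injective (Subtype.ext this.1)) this.2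
    · exact fun p => ⟨(hf0I _).1, fun h => (hf0I _).2 (Or.inl (Or.inl h))⟩
    · exact fun i p h => (hf0I _).2 (Or.inl (Or.inr ⟨i, h⟩))

/-- embedding of the almost indiscernible model over `D` -/
structure Emb (L : FirstOrder.Language.{u, v}) {N : Type w} [L.Structure N] (D MD : Set N) {k : ℕ}
    (I : Set (Fin k → N)) : Prop where
  sub : D ⊆ MD
  sat : ∀ A ⊆ MD, A.Countable → ∀ (n : ℕ) (a : Fin n → N), ∃ a' : Fin n → N, range a' ⊆ MD ∧ TA L A a a'
  ind : IsIndiscSet (L := L) I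
  unc : ¬ I.Countable
  crd : coords I ⊆ MD
  acl : ∀ x ∈ MD, AC L (coords I) (fun _ : Fin 1 => x)

theorem Emb.supp {D MD : Set N} {k : ℕ} {I : Set (Fin k → N)} (h : Emb L D MD I) {E : Set N}
    (hE : E ⊆ MD) (hEc : E.Countable) : ∃ J ⊆ I, J.Countable ∧ ∀ x ∈ E, AC L (coords J) (fun _ : Fin 1 => x) := by
  have h1 : ∀ x : E, ∃ F ⊆ I, F.Finite ∧ AC L (coords F) (fun _ : Fin 1 => (x : N)) := by
    intro x
    obtain ⟨P, hP, hPa⟩ := (h.acl x (hE x.2)).small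
    obtain ⟨F, hF, hFf, hPF⟩ := coords_fin P hP
    exact ⟨F, hF, hFf, hPa.mono hPF⟩
  choose F h1 h2 h3 using h1
  have : Countable E := hEc
  refine ⟨⋃ x, F x, iUnion_subset h1, countable_iUnion fun x => (h2 x).countable, fun x hx => ?_⟩
  exact (h3 ⟨x, hx⟩).mono (coords_mono (subset_iUnion F ⟨x, hx⟩))
end Acl

theorem emb_ex {T : L.Theory} (hcomp : T.IsComplete) (hai : AlmostIndiscernible T)
    {N : Type (max u v)} [L.Structure N] (hN : N ⊨ T) (m : Mon L N) (D : Set N) (hD : D.Countable) :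
    ∃ (MD : Set N) (k : ℕ) (I : Set (Fin k → N)), Emb L D MD I := by
  obtain ⟨M, _, hM, hMc, hMs, k, I, hI, hIc, hacl⟩ := hai
  have neN : Nonempty N := by
    rw [← mk_ne_zero_iff]
    exact (aleph0_pos.trans_le m.inf).ne'
  have neM : Nonempty M := by
    rw [← mk_ne_zero_iff, hMc]
    exact (aleph_pos 1).ne'
  have h0 : TE L (Empty.elim : Empty → N) (Empty.elim : Empty → M) := by
    intro φ
    have h1 := hcomp.realize_sentence_iff φ N
    have h2 := hcomp.realize_sentence_iff φ M
    have e1 : (Empty.elim : Empty → N) = default := Subsingleton.elim _ _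
    have e2 : (Empty.elim : Empty → M) = default := Subsingleton.elim _ _
    rw [e1, e2]
    exact h1.trans h2.symm
  have hal : ℵ₀ ≤ ℵ₁ := aleph0_le_aleph 1
  have hctM : ∀ A : Set M, A.Countable → #A < ℵ₁ := fun A hA =>
    (Cardinal.le_aleph0_iff_set_countable.2 hA).trans_lt aleph0_lt_aleph_one
  obtain ⟨c, hc⟩ := ext_many hal hMs h0 (hctM _ (countable_range _)) (ι' := D)
    ((Cardinal.le_aleph0_iff_set_countable.2 hD).trans_lt aleph0_lt_aleph_one) (fun d => (d : N))
  have hc' : TE L c (fun d : D => (d : N)) := (hc.comp Sum.inr).symm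
  obtain ⟨f, hf⟩ := ext_many m.inf m.sat hc' (by rw [Subtype.range_coe]; exact m.ctbl hD)
    (ι' := M) (by rw [hMc]; exact m.big) id
  have hf' : TE L (id : M → M) f := hf.comp Sum.inr
  have finj : Function.Injective f := fun x y h => (hf'.eq_iff x y).2 h
  have hfc : ∀ d : D, f (c d) = d := fun d =>
    ((hf.eq_iff (Sum.inl d) (Sum.inr (c d))).1 rfl).symm
  have finj' : Function.Injective (fun e : Fin k → M => f ∘ e) := finj.comp_left
  refine ⟨range f, k, (fun e => f ∘ e) '' I, ?_, ?_, ?_, ?_, ?_, ?_⟩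
  · exact fun d hd => ⟨c ⟨d, hd⟩, hfc ⟨d, hd⟩⟩
  · intro A hA hAc n a
    choose g hg using fun x : A => hA x.2
    have h1 : TE L (fun x : A => (x : N)) g := by
      have := (hf'.comp g).symm
      have e : f ∘ g = fun x : A => (x : N) := funext hg
      rwa [e] at this
    have : Countable A := hAc
    obtain ⟨a', ha'⟩ := ext_fin hal hMs h1 (hctM _ (countable_range _)) a
    refine ⟨f ∘ a', by rintro _ ⟨i, rfl⟩; exact ⟨_, rfl⟩, ?_⟩
    refine ha'.trans ?_
    have := hf'.comp (Sum.elim g a')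
    have e3 : f ∘ Sum.elim g a' = Sum.elim (fun x : A => (x : N)) (f ∘ a') := by
      funext i; rcases i with i | i
      · exact hg i
      · rfl
    rw [e3] at this
    exact this
  · intro n a b ha hb haI hbI φ
    choose a' ha' ha'' using haI
    choose b' hb' hb'' using hbI
    have ia : Function.Injective a' := fun i j h => ha (by rw [← ha'' i, ← ha'' j, h])
    have ib : Function.Injective b' := fun i j h => hb (by rw [← hb'' i, ← hb'' j, h])
    have h1 := hI n a' b' ia ib ha' hb' φ
    have h2 := (hf'.comp (fun p : Fin n × Fin k => a' p.1 p.2)) φ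
    have h3 := (hf'.comp (fun p : Fin n × Fin k => b' p.1 p.2)) φ
    have e1 : (fun p : Fin n × Fin k => a p.1 p.2) = f ∘ fun p : Fin n × Fin k => a' p.1 p.2 := by
      funext p; rw [← ha'' p.1]; rfl
    have e2 : (fun p : Fin n × Fin k => b p.1 p.2) = f ∘ fun p : Fin n × Fin k => b' p.1 p.2 := by
      funext p; rw [← hb'' p.1]; rfl
    rw [e1, e2]
    exact h2.symm.trans (h1.trans h3)
  · intro h
    have h1 : I.Countable := by
      have := h.preimage_of_injOn (f := fun e : Fin k → M => f ∘ e) finj'.injOn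
      exact this.mono (subset_preimage_image _ _)
    have := Cardinal.le_aleph0_iff_set_countable.2 h1
    rw [hIc] at this
    exact absurd this (not_le.2 aleph0_lt_aleph_one)
  · rintro x hx
    simp only [coords, mem_iUnion, exists_prop] at hx
    obtain ⟨_, ⟨e, he, rfl⟩, i, rfl⟩ := hx
    exact ⟨_, rfl⟩
  · rintro _ ⟨y, rfl⟩
    obtain ⟨φ, hφ, hfin⟩ := hacl y
    have hfin' : Finite {x : M | φ.Realize (Sum.elim (fun x : coords I => (x : M)) (fun _ => x))} := hfin
    refine ⟨{z | φ.Realize (Sum.elim (fun x : coords I => f x) z)}, ?_, ?_, ?_⟩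
    · refine ((def_range (fun x : coords I => f x) _).2 ⟨φ, rfl⟩).mono ?_
      rintro _ ⟨⟨x, hx⟩, rfl⟩
      simp only [coords, mem_iUnion, exists_prop] at hx ⊢
      obtain ⟨e, he, i, rfl⟩ := hx
      exact ⟨_, ⟨e, he, rfl⟩, i, rfl⟩
    · have := (hf'.comp (Sum.elim (fun x : coords I => (x : M)) (fun _ : Fin 1 => y))) φ
      have e1 : f ∘ Sum.elim (fun x : coords I => (x : M)) (fun _ : Fin 1 => y) =
        Sum.elim (fun x : coords I => f x) (fun _ => f y) := by
        funext i; rcases i with i | i <;> rfl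
      rw [e1] at this
      exact this.1 hφ
    · let S := {x : M | φ.Realize (Sum.elim (fun x : coords I => (x : M)) (fun _ => x))}
      let χ : L.Formula (M ⊕ Fin 1) := (φ.relabel (Sum.map (fun x : coords I => (x : M)) id)).imp
        (Formula.iSup (fun s : S => (Term.var (Sum.inr 0)).equal (Term.var (Sum.inl (s : M)))))
      have e1 : ∀ {Q : Type (max u v)} (h : M → Q) (z : Fin 1 → Q),
          Sum.elim h z ∘ Sum.map (fun x : coords I => (x : M)) id = Sum.elim (fun x : coords I => h x) z := by
        intro Q h z; funext i; rcases i with i | i <;> rfl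
      have h1 : ∀ z, χ.Realize (Sum.elim f z) := by
        refine (hf'.all χ).1 fun z => ?_
        simp only [χ, Formula.realize_imp, Formula.realize_relabel, e1, Formula.realize_iSup,
          Formula.realize_equal, Term.realize_var, Sum.elim_inl, Sum.elim_inr]
        intro hz
        have e2 : z = fun _ => z 0 := by funext i; rw [Subsingleton.elim i 0]
        rw [e2] at hz
        exact ⟨⟨z 0, hz⟩, rfl⟩
      have hfs : ((fun x (_ : Fin 1) => f x) '' S).Finite := hfin.image _
      refine hfs.subset fun z hz => ?_
      have := h1 z
      simp only [χ, Formula.realize_imp, Formula.realize_relabel, e1, Formula.realize_iSup,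
          Formula.realize_equal, Term.realize_var, Sum.elim_inl, Sum.elim_inr] at this
      obtain ⟨s, hs⟩ := this hz
      refine ⟨s, s.2, ?_⟩
      funext i; rw [Subsingleton.elim i 0, hs]
end Paper

namespace Paper
variable {L : FirstOrder.Language.{u, v}}

section TT
variable {N : Type w} [L.Structure N]

theorem countable_def [Countable L.Symbols] {E : Set N} (hE : E.Countable) {κ : Type*} [Countable κ] :
    {R : Set (κ → N) | E.Definable L R}.Countable := by
  have : Countable E := hE
  refine (countable_range (fun φ : L.Formula (E ⊕ κ) =>
    {x | φ.Realize (Sum.elim (fun a : E => (a : N)) x)})).mono ?_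
  intro R hR
  obtain ⟨φ, hφ⟩ := (def_set E R).1 hR
  exact ⟨φ, hφ.symm⟩

theorem rge_ta (m : Mon L N) {E : Set N} (hE : #E < #N) {n : ℕ} {κ : Type} [Finite κ] {c c' : κ → N}
    (h : TA L E c c') {R : Set (Fin n ⊕ κ → N)} (hR : E.Definable L R) {α : Ordinal.{0}}
    (hr : RGe L {x | Sum.elim x c ∈ R} α) : RGe L {x | Sum.elim x c' ∈ R} α := by
  obtain ⟨φ, rfl⟩ := (def_set _ _).1 hR
  let g : E ⊕ (Fin n ⊕ κ) → (E ⊕ κ) ⊕ Fin n :=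
    Sum.elim (fun i => Sum.inl (Sum.inl i)) (Sum.elim Sum.inr (fun i => Sum.inl (Sum.inr i)))
  have key : ∀ d : κ → N, {x : Fin n → N | Sum.elim x d ∈ {x | φ.Realize (Sum.elim (fun a : E => (a : N)) x)}} =
      {x | (φ.relabel g).Realize (Sum.elim (Sum.elim (fun a : E => (a : N)) d) x)} := by
    intro d
    ext x
    simp only [mem_ofPred_eq, Formula.realize_relabel]
    have : (Sum.elim (Sum.elim (fun a : E => (a : N)) d) x ∘ g) =
      Sum.elim (fun a : E => (a : N)) (Sum.elim x d) := by
      funext i; rcases i with i | i | i <;> rfl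
    rw [this]
  rw [key] at hr ⊢
  refine rge_inv m.sat m.big α h ?_ _ hr
  rw [Sum.elim_range, Subtype.range_coe]
  exact m.union hE (m.fin (finite_range c'))

theorem small_pigeon {C : Type*} [Small.{0} C] (P : C → Ordinal.{0} → Prop)
    (anti : ∀ q α β, α ≤ β → P q β → P q α) (h : ∀ α, ∃ q, P q α) : ∃ q, ∀ α, P q α := by
  by_contra hc
  push Not at hc
  choose f hf using hc
  obtain ⟨s, hs⟩ : BddAbove (range f) := Ordinal.bddAbove_of_small
  obtain ⟨q, hq⟩ := h s
  exact hf q (anti q _ _ (hs ⟨q, rfl⟩) hq)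

theorem tt_split [Countable L.Symbols] (m : Mon L N) {n : ℕ} (X : Set (Fin n → N))
    (hX : (Set.univ : Set N).Definable L X) (hU : ∀ α, RGe L X α) :
    ∃ Y, (Set.univ : Set N).Definable L Y ∧ (∀ α, RGe L (X ∩ Y) α) ∧ ∀ α, RGe L (X \ Y) α := by
  obtain ⟨P, -, hP⟩ := definable_iff_finitely_definable.1 hX
  set E : Set N := (P : Set N) with hE
  have hEc : E.Countable := P.countable_toSet
  have hEs : #E < #N := m.ctbl hEc
  let C := Σ k : ℕ, {R : Set (Fin n ⊕ Fin k → N) | E.Definable L R} × 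
    Set {R : Set (Fin k → N) | E.Definable L R}
  have c1 : ∀ k, Small.{0} {R : Set (Fin n ⊕ Fin k → N) | E.Definable L R} := fun k => by
    have : Countable {R : Set (Fin n ⊕ Fin k → N) | E.Definable L R} := countable_def hEc
    exact Countable.toSmall _
  have c2 : ∀ k, Small.{0} {R : Set (Fin k → N) | E.Definable L R} := fun k => by
    have : Countable {R : Set (Fin k → N) | E.Definable L R} := countable_def hEc
    exact Countable.toSmall _
  have c3 : ∀ k, Small.{0} (Set {R : Set (Fin k → N) | E.Definable L R}) := fun k => by
    infer_instance
  have : Small.{0} C := by infer_instance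
  obtain ⟨⟨k, ⟨R, hR⟩, S⟩, hq⟩ := small_pigeon (C := C) (fun q α => ∃ c : Fin q.1 → N,
      {R : {R : Set (Fin q.1 → N) | E.Definable L R} | c ∈ R.1} = q.2.2 ∧
      RGe L (X ∩ {x | Sum.elim x c ∈ q.2.1.1}) α ∧ RGe L (X \ {x | Sum.elim x c ∈ q.2.1.1}) α)
    (by
      rintro q α β hαβ ⟨c, h1, h2, h3⟩
      exact ⟨c, h1, h2.anti hαβ, h3.anti hαβ⟩)
    (by
      intro α
      have h := hU (α + 1)
      rw [RGe] at h
      obtain ⟨Y, h1, h2, h3, h4⟩ := h.2 α (Order.lt_add_one_iff.2 le_rfl)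
      obtain ⟨Q, -, hQ⟩ := definable_iff_finitely_definable.1 (h1 0)
      obtain ⟨k, c, hc⟩ := fin_enum Q
      obtain ⟨R, hR, hYR⟩ := (def_fib E c (Y 0)).1 (hQ.mono (by rw [hc]; exact subset_union_right))
      refine ⟨⟨k, ⟨R, hR⟩, {R : {R : Set (Fin k → N) | E.Definable L R} | c ∈ R.1}⟩, c, rfl, ?_, ?_⟩
      · show RGe L (X ∩ {x | Sum.elim x c ∈ R}) α
        rw [← hYR]
        exact (h4 0).mono fun a ha => ⟨h2 0 ha, ha⟩
      · show RGe L (X \ {x | Sum.elim x c ∈ R}) α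
        rw [← hYR]
        exact (h4 1).mono fun a ha => ⟨h2 1 ha, fun hc => Set.disjoint_left.1 (h3 0 1 (by simp)) hc ha⟩)
  dsimp only at hq
  have hR' : E.Definable L R := hR
  obtain ⟨c, hc, -⟩ := hq 0
  have hX1 : E.Definable L {y : Fin n ⊕ Fin k → N | (y ∘ Sum.inl) ∈ X} := hP.preimage_comp Sum.inl
  refine ⟨{x | Sum.elim x c ∈ R}, ((def_fib E c _).2 ⟨R, hR', rfl⟩).mono (subset_univ _), ?_⟩
  have hT : ∀ α, ∃ c' : Fin k → N, TA L E c' c ∧ RGe L (X ∩ {x | Sum.elim x c' ∈ R}) α ∧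
      RGe L (X \ {x | Sum.elim x c' ∈ R}) α := by
    intro α
    obtain ⟨c', h1, h2⟩ := hq α
    refine ⟨c', TA.of_mem fun Z hZ hcZ => ?_, h2⟩
    have : (⟨Z, hZ⟩ : {R : Set (Fin k → N) | E.Definable L R}) ∈ S := by
      rw [← h1]; exact hcZ
    rw [← hc] at this
    exact this
  constructor
  · intro α
    obtain ⟨c', h1, h2, h3⟩ := hT α
    exact rge_ta m hEs h1 (hX1.inter hR') h2
  · intro α
    obtain ⟨c', h1, h2, h3⟩ := hT α
    exact rge_ta m hEs h1 (hX1.sdiff hR') h3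

def pre (σ : ℕ → Bool) : ℕ → List Bool
  | 0 => []
  | k + 1 => σ k :: pre σ k

theorem tt_tree [Countable L.Symbols] (m : Mon L N) {n : ℕ} (X : Set (Fin n → N))
    (hX : (Set.univ : Set N).Definable L X) (hU : ∀ α, RGe L X α) :
    ∃ (D : Set N) (a : (ℕ → Bool) → Fin n → N), D.Countable ∧ ∀ σ τ, TA L D (a σ) (a τ) → σ = τ := by
  classical
  choose! S h1 h2 h3 using fun X hX hU => tt_split (L := L) m (n := n) X hX hU
  let T : List Bool → Set (Fin n → N) := fun l => l.rec X (fun b _ Z => if b then Z ∩ S Z else Z \ S Z)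
  have hTc : ∀ b l, T (b :: l) = if b then T l ∩ S (T l) else T l \ S (T l) := fun b l => rfl
  have hT : ∀ l, (Set.univ : Set N).Definable L (T l) ∧ ∀ α, RGe L (T l) α := by
    intro l
    induction l with
    | nil => exact ⟨hX, hU⟩
    | cons b l ih =>
      rw [hTc]
      cases b
      · exact ⟨ih.1.sdiff (h1 _ ih.1 ih.2), h3 _ ih.1 ih.2⟩
      · exact ⟨ih.1.inter (h1 _ ih.1 ih.2), h2 _ ih.1 ih.2⟩
  have hsub : ∀ b l, T (b :: l) ⊆ T l := by
    intro b l
    rw [hTc]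
    cases b
    · exact sdiff_subset
    · exact inter_subset_left
  choose P _ hP using fun l => definable_iff_finitely_definable.1 (hT l).1
  let D : Set N := ⋃ l, (P l : Set N)
  have hD : D.Countable := countable_iUnion fun l => (P l).countable_toSet
  have hTD : ∀ l, D.Definable L (T l) := fun l => (hP l).mono (subset_iUnion (fun l => (P l : Set N)) l)
  have hanti : ∀ σ, Antitone fun k => T (pre σ k) := fun σ => antitone_nat_of_succ_le fun k => hsub _ _
  have hbr : ∀ σ, ∃ a : Fin n → N, ∀ k, a ∈ T (pre σ k) := by
    intro σ
    obtain ⟨a, ha, -⟩ := gen m.sat m.big D (m.ctbl hD) 0 (range fun k => T (pre σ k)) ⟨_, 0, rfl⟩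
      (by
        rintro _ ⟨k, rfl⟩ _ ⟨l, rfl⟩
        rcases le_total k l with h | h
        · exact ⟨l, (inter_eq_right.2 (hanti σ h)).symm⟩
        · exact ⟨k, (inter_eq_left.2 (hanti σ h)).symm⟩)
      (by rintro _ ⟨k, rfl⟩; exact (hT _).2 0)
      (by rintro _ ⟨k, rfl⟩; exact hTD _)
    exact ⟨a, fun k => ha _ ⟨k, rfl⟩⟩
  choose a ha using hbr
  refine ⟨D, a, hD, fun σ τ hTA => ?_⟩
  by_contra hne
  have hex : ∃ k, σ k ≠ τ k := by
    by_contra hc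
    push Not at hc
    exact hne (funext hc)
  have hpre : ∀ k ≤ Nat.find hex, pre σ k = pre τ k := by
    intro k hk
    induction k with
    | zero => rfl
    | succ k ih =>
      have := Nat.find_min hex hk
      push Not at this
      simp only [pre, this, ih (by omega)]
  have hs := ha σ (Nat.find hex + 1)
  have ht := ha τ (Nat.find hex + 1)
  have hs' := (hTA.mem (hTD (pre σ (Nat.find hex + 1)))).1 hs
  have hfd := Nat.find_spec hex
  simp only [pre] at ht hs'
  rw [hpre _ le_rfl, hTc] at hs'
  rw [hTc] at ht
  rcases hb : σ (Nat.find hex) <;> rcases hb' : τ (Nat.find hex) <;> rw [hb, hb'] at hfd <;>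
    simp [hb] at hs' <;> simp [hb'] at ht
  · exact hfd rfl
  · exact hs'.2 ht.2
  · exact ht.2 hs'.2
  · exact hfd rfl

theorem AC.of_mem {A : Set N} {x : N} (hx : x ∈ A) : AC L A (fun _ : Fin 1 => x) := by
  refine ⟨{fun _ => x}, ?_, rfl, finite_singleton _⟩
  rw [def_set]
  refine ⟨(Term.var (Sum.inr 0)).equal (Term.var (Sum.inl ⟨x, hx⟩)), ?_⟩
  ext y
  simp only [mem_singleton_iff, mem_ofPred_eq, Formula.realize_equal, Term.realize_var, Sum.elim_inr,
    Sum.elim_inl, funext_iff]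
  constructor
  · intro h; exact h 0
  · intro h i; rw [Subsingleton.elim i 0]; exact h

theorem finset_inj {k : ℕ} {F : Set (Fin k → N)} (hF : F.Finite) :
    ∃ r, ∃ e : Fin r → Fin k → N, Function.Injective e ∧ range e = F := by
  classical
  let P := hF.toFinset
  refine ⟨P.card, fun i => (P.equivFin.symm i : Fin k → N),
    Subtype.val_injective.comp P.equivFin.symm.injective, ?_⟩
  ext x
  constructor
  · rintro ⟨i, rfl⟩; exact hF.mem_toFinset.1 (P.equivFin.symm i).2
  · intro hx; exact ⟨P.equivFin ⟨x, hF.mem_toFinset.2 hx⟩, by simp⟩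

theorem coords_range_fin {k r : ℕ} (e : Fin r → Fin k → N) :
    coords (range e) = range (fun p : Fin r × Fin k => e p.1 p.2) := by
  ext x
  simp [coords]

theorem coords_union {k : ℕ} (I J : Set (Fin k → N)) : coords (I ∪ J) = coords I ∪ coords J := by
  simp only [coords, biUnion_union]

theorem tt_main [Countable L.Symbols] (m : Mon L N)
    (hemb : ∀ D : Set N, D.Countable → ∃ (MD : Set N) (k : ℕ) (I : Set (Fin k → N)), Emb L D MD I) :
    TTr L N := by
  classical
  intro n X hX
  by_contra hU
  push Not at hU
  obtain ⟨D, a0, hD, ha0⟩ := tt_tree m X hX hU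
  obtain ⟨MD, k, I, hE⟩ := hemb D hD
  choose a haM haT using fun σ => hE.sat D hE.sub hD n (a0 σ)
  have ha : ∀ σ τ, TA L D (a σ) (a τ) → σ = τ := fun σ τ h =>
    ha0 σ τ (((haT σ).trans h).trans (haT τ).symm)
  obtain ⟨J, hJI, hJ, hJD⟩ := hE.supp hE.sub hD
  have hcJ := coords_ctbl hJ
  have hcode : ∀ σ, ∃ (r : ℕ) (F : Fin r → Fin k → N) (R : Set (Fin n ⊕ (Fin r × Fin k) → N)),
      Function.Injective F ∧ (∀ i, F i ∈ I \ J) ∧ (coords J).Definable L R ∧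
      Sum.elim (a σ) (fun p => F p.1 p.2) ∈ R ∧ {x | Sum.elim x (fun p => F p.1 p.2) ∈ R}.Finite := by
    intro σ
    have h1 : AC L (coords I) (a σ) := AC.tuple fun i => hE.acl _ (haM σ ⟨i, rfl⟩)
    obtain ⟨P, hP, h2⟩ := h1.small
    obtain ⟨F, hFI, hFf, hPF⟩ := coords_fin P hP
    obtain ⟨r, e, he, hr⟩ := finset_inj (hFf.sdiff (t := J))
    have h3 : AC L (coords J ∪ range (fun p : Fin r × Fin k => e p.1 p.2)) (a σ) := by
      refine h2.mono (hPF.trans ?_)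
      rw [← coords_range_fin, hr, ← coords_union]
      exact coords_mono (by simp)
    obtain ⟨Z, hZ, haZ, hZf⟩ := h3
    obtain ⟨R, hR, rfl⟩ := (def_fib _ _ _).1 hZ
    refine ⟨r, e, R, he, fun i => ?_, hR, haZ, hZf⟩
    have : e i ∈ F \ J := hr ▸ mem_range_self i
    exact ⟨hFI this.1, this.2⟩
  let C := Σ r : ℕ, {R : Set (Fin n ⊕ (Fin r × Fin k) → N) | (coords J).Definable L R}
  have : ∀ r, Countable {R : Set (Fin n ⊕ (Fin r × Fin k) → N) | (coords J).Definable L R} :=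
    fun r => countable_def hcJ
  have : Countable C := by infer_instance
  have hcode' : ∀ σ, ∃ (q : C) (F : Fin q.1 → Fin k → N),
      Function.Injective F ∧ (∀ i, F i ∈ I \ J) ∧
      Sum.elim (a σ) (fun p => F p.1 p.2) ∈ q.2.1 ∧ {x | Sum.elim x (fun p => F p.1 p.2) ∈ q.2.1}.Finite := by
    intro σ
    obtain ⟨r, F, R, h1, h2, h3, h4, h5⟩ := hcode σ
    exact ⟨⟨r, R, h3⟩, F, h1, h2, h4, h5⟩
  choose cd hcd using hcode'
  obtain ⟨q, hq⟩ : ∃ q : C, (cd ⁻¹' {q}).Infinite := by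
    by_contra hc
    push Not at hc
    have h1 : (Set.univ : Set (ℕ → Bool)).Countable := by
      have h2 : (⋃ q : C, cd ⁻¹' {q}).Countable :=
        countable_iUnion fun q => Set.Finite.countable (hc q)
      exact h2.mono fun σ _ => mem_iUnion.2 ⟨cd σ, rfl⟩
    have h3 : Countable (ℕ → Bool) := countable_univ_iff.1 h1
    have h4 := Cardinal.mk_le_aleph0_iff.2 h3
    have h5 : #(ℕ → Bool) = 2 ^ ℵ₀ := by rw [← power_def]; simp
    rw [h5] at h4
    exact absurd h4 (not_le.2 (cantor ℵ₀))
  obtain ⟨r0, R0, hR0⟩ := q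
  -- data rewritten over the fixed code
  have hfix : ∀ σ ∈ (cd ⁻¹' {⟨r0, R0, hR0⟩}), ∃ G : Fin r0 → Fin k → N,
      Function.Injective G ∧ (∀ i, G i ∈ I \ J) ∧
      Sum.elim (a σ) (fun p => G p.1 p.2) ∈ R0 ∧ {x | Sum.elim x (fun p => G p.1 p.2) ∈ R0}.Finite := by
    intro σ hσ
    have h := hcd σ
    rw [show cd σ = ⟨r0, R0, hR0⟩ from hσ] at h
    exact h
  obtain ⟨σ0, hσ0⟩ := hq.nonempty
  obtain ⟨G0, hG0, hGI0, -, hGf⟩ := hfix σ0 hσ0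
  have hmove : ∀ σ ∈ (cd ⁻¹' {⟨r0, R0, hR0⟩}), ∃ b : Fin n → N,
      Sum.elim b (fun p => G0 p.1 p.2) ∈ R0 ∧ TA L D (a σ) b := by
    intro σ hσ
    obtain ⟨G, hG, hGI, h1, h2⟩ := hfix σ hσ
    have h3 := aclind m hE.ind hE.unc hJI hJ hG hGI hG0 hGI0 (E := D ∪ coords J) (by
      rintro x (hx | hx)
      · exact hJD x hx
      · exact AC.of_mem hx)
    obtain ⟨b, hb⟩ := m.ext (m.ctbl (hD.union hcJ)) h3 (a σ)
    exact ⟨b, ((hb.swap.mono subset_union_right).mem hR0).1 h1, hb.right.mono subset_union_left⟩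
  have : Nonempty N := by
    rw [← mk_ne_zero_iff]
    exact (aleph0_pos.trans_le m.inf).ne'
  choose! b hb1 hb2 using hmove
  refine hq (Set.Finite.of_finite_image (f := b) (hGf.subset ?_) ?_)
  · rintro _ ⟨σ, hσ, rfl⟩
    exact hb1 σ hσ
  · intro σ hσ τ hτ h
    refine ha σ τ ((hb2 σ hσ).trans ?_)
    rw [h]
    exact (hb2 τ hτ).symm
end TT
end Paper

namespace Paper
variable {L : FirstOrder.Language.{u, v}}

section Main
variable {N : Type w} [L.Structure N]

theorem acl1 (m : Mon L N) {D MD : Set N} {k : ℕ} {I : Set (Fin k → N)} (h : Emb L D MD I)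
    {J : Set (Fin k → N)} (hJ : J ⊆ I) (hJc : J.Countable)
    (hD : ∀ x ∈ D, AC L (coords J) (fun _ : Fin 1 => x)) {e e' : Fin k → N} (he : e ∈ I \ J)
    (he' : e' ∈ I \ J) : TA L (coords J ∪ D) e e' := by
  have h1 := aclind m h.ind h.unc hJ hJc (r := 1) (F := fun _ => e) (F' := fun _ => e')
    (Function.injective_of_subsingleton _) (fun _ => he)
    (Function.injective_of_subsingleton _) (fun _ => he') (E := coords J ∪ D) (by
      rintro x (hx | hx)
      · exact AC.of_mem hx
      · exact hD x hx)
  exact h1.comp (fun i => ((0 : Fin 1), i))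

theorem base (m : Mon L N) (tt : TTr L N) {D MD : Set N} {k : ℕ} {I : Set (Fin k → N)} (h : Emb L D MD I)
    (hDc : D.Countable) : ∃ (J₀ : Set (Fin k → N)) (ρ : Ordinal.{0}), J₀ ⊆ I ∧ J₀.Countable ∧
      (∀ x ∈ D, AC L (coords J₀) (fun _ : Fin 1 => x)) ∧
      ∀ J, J₀ ⊆ J → J ⊆ I → J.Countable → ∀ e ∈ I \ J,
        Gn L (coords J ∪ D) e ρ ∧ ¬ Gn L (coords J ∪ D) e (ρ + 1) := by
  let Q : Set Ordinal.{0} := {ρ | ∃ J ⊆ I, J.Countable ∧ (∀ x ∈ D, AC L (coords J) (fun _ : Fin 1 => x)) ∧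
    ∃ e ∈ I \ J, ¬ Gn L (coords J ∪ D) e (ρ + 1)}
  have hr : ∀ J ⊆ I, J.Countable → (∀ x ∈ D, AC L (coords J) (fun _ : Fin 1 => x)) →
      ∀ e ∈ I \ J, ∃ ρ ∈ Q, Gn L (coords J ∪ D) e ρ := by
    intro J h1 h2 h3 e he
    obtain ⟨ρ, X, hX, heX, hg, hr⟩ := rank_ex tt (coords J ∪ D) e
    exact ⟨ρ, ⟨J, h1, h2, h3, e, he, fun hc => hr (hc X hX heX)⟩, hg⟩
  have hout : ∀ J : Set (Fin k → N), J.Countable → (I \ J).Nonempty := by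
    intro J hJ
    by_contra hc
    rw [not_nonempty_iff_eq_empty, sdiff_eq_empty] at hc
    exact h.unc (hJ.mono hc)
  have hne : Q.Nonempty := by
    obtain ⟨J, h1, h2, h3⟩ := h.supp h.sub hDc
    obtain ⟨e, he⟩ := hout J h2
    obtain ⟨ρ, hρ, -⟩ := hr J h1 h2 h3 e he
    exact ⟨ρ, hρ⟩
  obtain ⟨J₀, h1, h2, h3, e₀, he₀, h4⟩ := csInf_mem hne
  refine ⟨J₀, sInf Q, h1, h2, h3, fun J hJ hJI hJc e he => ⟨?_, fun hc => h4 ?_⟩⟩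
  · obtain ⟨ρ, hρ, hg⟩ := hr J hJI hJc (fun x hx => (h3 x hx).mono (coords_mono hJ)) e he
    exact hg.anti (csInf_le' hρ)
  · have := hc.anti_set (A := coords J₀ ∪ D) (union_subset_union_left _ (coords_mono hJ))
    exact m.gn0 (acl1 m h h1 h2 h3 ⟨he.1, fun hc => he.2 (hJ hc)⟩ he₀) this

theorem stepB {D MD : Set N} {k : ℕ} {I : Set (Fin k → N)} (h : Emb L D MD I)
    {J₀ : Set (Fin k → N)} {n : ℕ} {b : Fin n → N} (hb : range b ⊆ MD) {α : Ordinal.{0}} (hα : 1 ≤ α)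
    (hg : Gn L (coords J₀ ∪ D) b α) : ∃ (F : Set (Fin k → N)) (e : Fin k → N), F.Finite ∧ F ⊆ I ∧
      e ∈ I \ (J₀ ∪ F) ∧ Gn L (coords (J₀ ∪ F) ∪ D) b α ∧
      ¬ Gn L ((coords (J₀ ∪ F) ∪ D) ∪ range e) b α := by
  by_contra hcon
  push Not at hcon
  have key : ∀ F : Set (Fin k → N), F.Finite → F ⊆ I → Gn L (coords (J₀ ∪ F) ∪ D) b α := by
    intro F hF
    induction F, hF using Set.Finite.induction_on with
    | empty => intro _; simpa using hg
    | @insert e F _ hF ih =>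
      intro hI
      have h1 := ih ((subset_insert _ _).trans hI)
      by_cases he : e ∈ J₀ ∪ F
      · refine h1.anti_set (union_subset_union_left _ (coords_mono ?_))
        rintro x (hx | rfl | hx)
        · exact Or.inl hx
        · exact he
        · exact Or.inr hx
      · have h2 := hcon F e hF ((subset_insert _ _).trans hI) ⟨hI (mem_insert _ _), he⟩ h1
        refine h2.anti_set ?_
        have : J₀ ∪ insert e F = (J₀ ∪ F) ∪ {e} := by
          ext x; simp only [mem_union, mem_insert_iff, mem_singleton_iff]; tauto
        rw [this, coords_union]
        have h3 : coords {e} = range e := by simp [coords]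
        rw [h3]
        intro x hx
        simp only [mem_union] at hx ⊢
        tauto
  have h1 : AC L (coords I) b := AC.tuple fun i => h.acl _ (hb ⟨i, rfl⟩)
  obtain ⟨P, hP, h2⟩ := h1.small
  obtain ⟨F, hFI, hFf, hPF⟩ := coords_fin P hP
  obtain ⟨Z, hZ, hbZ, hZf⟩ := h2
  refine not_rge_one_of_finite hZf ((key F hFf hFI Z (hZ.mono (hPF.trans ?_)) hbZ).anti hα)
  exact (coords_mono subset_union_right).trans subset_union_left

/-- the increasing chain of parameter sets -/
def Chn (C : Set N) {n : ℕ → ℕ} (b : ∀ i, Fin (n i) → N) : ℕ → Set N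
  | 0 => C
  | j + 1 => Chn C b j ∪ range (b j)

theorem main_seq (m : Mon L N) (tt : TTr L N)
    (hemb : ∀ D : Set N, D.Countable → ∃ (MD : Set N) (k : ℕ) (I : Set (Fin k → N)), Emb L D MD I)
    (B : ℕ → Set N) (n : ℕ → ℕ) (b : ∀ i, Fin (n i) → N) (hB : ∀ i, #(B i) < #N)
    (hreg : ∀ i, Regular (L := L) #N (B i) (b i))
    (hno : ∀ i j, i < j → ¬ Nonorthogonal (L := L) #N (B j) (b j) (B i) (b i)) : False := by
  choose P X α hred using fun i => finred m tt (hB i) (hreg i)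
  have hDc : (⋃ i, P i).Countable := countable_iUnion fun i => (hred i).fin.countable
  obtain ⟨MD, k, I, hE⟩ := hemb _ hDc
  generalize hD : (⋃ i, P i) = D at *
  have hPD : ∀ i, P i ⊆ D := fun i => hD ▸ subset_iUnion P i
  obtain ⟨J₀, ρ, hJ₀I, hJ₀c, hJ₀D, hρ⟩ := base m tt hE hDc
  have hb0 : ∀ i, ∃ c : Fin (n i) → N, range c ⊆ MD ∧ c ∈ X i ∧ Gn L (coords J₀ ∪ D) c (α i) := by
    intro i
    have hA : (coords J₀ ∪ D).Countable := (coords_ctbl hJ₀c).union hDc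
    have hXd : (coords J₀ ∪ D).Definable L (X i) := (hred i).df.mono ((hPD i).trans subset_union_right)
    obtain ⟨a, ha, hga⟩ := gen m.sat m.big (coords J₀ ∪ D) (m.ctbl hA) (α i) {X i}
      (singleton_nonempty _) (by simp) (by
        rintro _ rfl
        exact (hred i).deg.1) (by
        rintro _ rfl
        exact hXd)
    obtain ⟨c, hc, hac⟩ := hE.sat _ (union_subset ((coords_mono hJ₀I).trans hE.crd) hE.sub) hA _ a
    exact ⟨c, hc, (hac.mem hXd).1 (ha _ rfl), m.gn0 hac hga⟩
  choose c hcM hcX hcg using hb0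
  choose F e hFf hFI he hg1 hg2 using fun i => stepB hE (hcM i) (hred i).pos (hcg i)
  let J := J₀ ∪ ⋃ i, F i
  have hJc : J.Countable := hJ₀c.union (countable_iUnion fun i => (hFf i).countable)
  have hJI : J ⊆ I := union_subset hJ₀I (iUnion_subset hFI)
  obtain ⟨es, hes⟩ : (I \ J).Nonempty := by
    by_contra hc
    rw [not_nonempty_iff_eq_empty, sdiff_eq_empty] at hc
    exact hE.unc (hJc.mono hc)
  let C := coords J ∪ D
  have hCc : C.Countable := (coords_ctbl hJc).union hDc
  have hFJ : ∀ i, J₀ ∪ F i ⊆ J := fun i => union_subset_union_right _ (subset_iUnion F i)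
  have hd : ∀ i, ∃ d : Fin (n i) → N, d ∈ X i ∧ Gn L C d (α i) ∧ ¬ Gn L (C ∪ range es) d (α i) := by
    intro i
    set A := coords (J₀ ∪ F i) ∪ D with hAdef
    have hJi : (J₀ ∪ F i).Countable := hJ₀c.union (hFf i).countable
    have hJiI : J₀ ∪ F i ⊆ I := union_subset hJ₀I (hFI i)
    have hAC : A ⊆ C := union_subset_union_left _ (coords_mono (hFJ i))
    have hA : #A < #N := m.ctbl (hCc.mono hAC)
    have hesi : es ∈ I \ (J₀ ∪ F i) := ⟨hes.1, fun hc => hes.2 (hFJ i hc)⟩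
    have ht : TA L A (e i) es := acl1 m hE hJiI hJi
      (fun x hx => (hJ₀D x hx).mono (coords_mono subset_union_left)) (he i) hesi
    obtain ⟨b', hb'⟩ := m.ext hA ht (c i)
    obtain ⟨d, hd, hdi⟩ := m.nfe tt (A := A ∪ range es) (D := (A ∪ range es) ∪ C) subset_union_left
      (m.union (m.union hA (m.rng _)) (m.ctbl hCc)) b'
    have hes1 : Ind L A es (A ∪ C) := by
      rw [union_eq_right.2 hAC]
      intro γ hγ
      refine (hρ J subset_union_left hJI hJc es hes).1.anti ?_
      by_contra hc
      exact (hρ _ subset_union_left hJiI hJi es hesi).2 (hγ.anti (Order.add_one_le_of_lt (not_le.1 hc)))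
    have hP := lemP m tt hA hes1 hdi
    rw [union_eq_right.2 hAC] at hP
    have htd : TA L A (c i) d := hb'.right.trans (hd.mono subset_union_left)
    refine ⟨d, (htd.mem ((hred i).df.mono ((hPD i).trans subset_union_right))).1 (hcX i),
      hP _ (m.gn0 htd (hg1 i)), fun hc => hg2 i ?_⟩
    have h1 := hc.anti_set (union_subset_union_left (range es) hAC)
    exact m.gn hA hb'.symm (m.gn0 hd.symm h1)
  choose d hdX hdg hdn using hd
  have hsub : ∀ j, C ⊆ Chn C d j := by
    intro j
    induction j with
    | zero => exact Subset.rfl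
    | succ j ih => exact ih.trans subset_union_left
  have hsm : ∀ j, #(Chn C d j) < #N := by
    intro j
    induction j with
    | zero => exact m.ctbl hCc
    | succ j ih => exact m.union ih (m.rng _)
  have hPC : ∀ i j, P i ⊆ Chn C d j := fun i j => ((hPD i).trans subset_union_right).trans (hsub j)
  have hgn : ∀ j l, j ≤ l → Gn L (Chn C d j) (d l) (α l) := by
    intro j
    induction j with
    | zero => intro l _; exact hdg l
    | succ j ih =>
      intro l hl
      exact orth m tt (hB j) (hB l) (hred j) (hred l) (hno j l hl) (hsm j) (hPC j j) (hPC l j)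
        (hdX j) (hdX l) (ih j le_rfl) (ih l (by omega))
  have hstep : ∀ j, ∃ γ, Gn L (Chn C d j) es γ ∧ ¬ Gn L (Chn C d (j + 1)) es γ := by
    intro j
    by_contra hc
    push Not at hc
    have h1 : Ind L (Chn C d j) es (Chn C d j ∪ range (d j)) := hc
    have h2 := sym m tt (hsm j) h1
    exact hdn j ((h2 _ (hgn j j le_rfl)).anti_set (union_subset_union_left _ (hsub j)))
  choose γ h1 h2 using hstep
  have hrk : ∀ j, ∃ σ, Gn L (Chn C d j) es σ ∧ ¬ Gn L (Chn C d j) es (σ + 1) := by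
    intro j
    obtain ⟨σ, X, hX, heX, hg, hr⟩ := rank_ex tt (Chn C d j) es
    exact ⟨σ, hg, fun hc => hr (hc X hX heX)⟩
  choose σ h3 h4 using hrk
  have hlt : ∀ j, σ (j + 1) < σ j := by
    intro j
    have a1 : γ j ≤ σ j := by
      by_contra hc
      exact h4 j ((h1 j).anti (Order.add_one_le_of_lt (not_le.1 hc)))
    refine lt_of_lt_of_le ?_ a1
    by_contra hc
    exact h2 j ((h3 (j + 1)).anti (not_lt.1 hc))
  exact not_strictAnti_of_wellFoundedLT σ (strictAnti_nat_of_succ_lt hlt)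

theorem final {L : FirstOrder.Language.{u, v}} (hL : L.card ≤ ℵ₀)
    (T : L.Theory) (hcomp : T.IsComplete) (hai : AlmostIndiscernible T)
    (N : Type (max u v)) [L.Structure N] (hN : N ⊨ T)
    (hsat : IsSat (L := L) N (#N)) (hbig : ℵ₁ < #N) :
    ∃ (m : ℕ) (As : Fin m → Set N) (ks : Fin m → ℕ) (as : ∀ i : Fin m, Fin (ks i) → N),
      (∀ i : Fin m, #(As i) < #N ∧ Regular (L := L) (#N) (As i) (as i)) ∧
      ∀ (B : Set N), #B < #N → ∀ (l : ℕ) (b : Fin l → N), Regular (L := L) (#N) B b →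
        ∃ i : Fin m, Nonorthogonal (L := L) (#N) B b (As i) (as i) := by
  classical
  have : Countable L.Symbols := mk_le_aleph0_iff.1 hL
  have m : Mon L N := ⟨hsat, hbig⟩
  have hemb := emb_ex hcomp hai hN m
  have tt : TTr L N := tt_main m hemb
  by_contra hcon
  push Not at hcon
  let Dt := Σ (_ : Set N) (l : ℕ), Fin l → N
  obtain ⟨f, hf1, hf2⟩ := exists_seq_of_forall_finset_exists (α := Dt)
    (fun x => #x.1 < #N ∧ Regular (L := L) #N x.1 x.2.2)
    (fun x y => ¬ Nonorthogonal (L := L) #N y.1 y.2.2 x.1 x.2.2) (by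
      intro s hs
      let g : Fin s.card → Dt := fun i => (s.equivFin.symm i : Dt)
      obtain ⟨B, hB, l, b, hreg, hno⟩ := hcon s.card (fun i => (g i).1) (fun i => (g i).2.1)
        (fun i => (g i).2.2) (fun i => hs _ (s.equivFin.symm i).2)
      refine ⟨⟨B, l, b⟩, ⟨hB, hreg⟩, fun x hx => ?_⟩
      have := hno (s.equivFin ⟨x, hx⟩)
      have hg : g (s.equivFin ⟨x, hx⟩) = x := by simp [g]
      dsimp only at this ⊢
      rw [hg] at this
      exact this)
  exact main_seq m tt hemb (fun i => (f i).1) (fun i => (f i).2.1) (fun i => (f i).2.2)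
    (fun i => (hf1 i).1) (fun i => (hf1 i).2) hf2
end Main
end Paper

open Paper in
/-- every almost indiscernible countable complete theory is finite-dimensional:
in a saturated (monster) model there are finitely many regular types up to nonorthogonality. -/
theorem stmt_17 {L : FirstOrder.Language.{u, v}} (hL : L.card ≤ ℵ₀)
    (T : L.Theory) (hcomp : T.IsComplete) (hai : AlmostIndiscernible T)
    (N : Type (max u v)) [L.Structure N] (hN : N ⊨ T)
    (hsat : IsSat (L := L) N (#N)) (hbig : ℵ₁ < #N) :
    ∃ (m : ℕ) (As : Fin m → Set N) (ks : Fin m → ℕ) (as : ∀ i : Fin m, Fin (ks i) → N),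
      (∀ i : Fin m, #(As i) < #N ∧ Regular (L := L) (#N) (As i) (as i)) ∧
      ∀ (B : Set N), #B < #N → ∀ (l : ℕ) (b : Fin l → N), Regular (L := L) (#N) B b →
        ∃ i : Fin m, Nonorthogonal (L := L) (#N) B b (As i) (as i) :=
  Paper.final hL T hcomp hai N hN hsat hbig
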